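/- Let q be a prime power, n ≥ 1, and let α ∈ F_{q^2} \ F_q with d the multiplicative order of α^{q-1} in F_{q^2}^*. Let σ be the F_q-automorphism of F_q(X) with σ(X) = ((α + α^q)X - α^{1+q})/X. Then: if d divides n and d is even, Fix(σ) = q^{2n/d - 2} + (q+1)(q^{2n/d} - (-1)^{n/d})/(q^2 + 1); if d divides n and d is odd, Fix(σ) = q^{2n/d - 2}; if d does not divide n, Fix(σ) = [(-1)^{⌊n/d⌋}(1+q) + q^{2⌊n/d⌋+1}(q-1)]/(1 + q^2). -/

import Mathlib

open Polynomial

/-! ### Homogeneous substitution -/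

/-- The value `∑ pᵢ aⁱ bⁿ⁻ⁱ` of the degree `n` homogenization of `p` at `(a, b)`. -/
noncomputable def homSubst {R S : Type*} [CommRing R] [CommRing S] [Algebra R S]
    (n : ℕ) (a b : S) : R[X] →ₗ[R] S :=
  (MvPolynomial.aeval ![a, b]).toLinearMap ∘ₗ homogenizeLM n

section HomSubst

variable {R S : Type*} [CommRing R] [CommRing S] [Algebra R S]

theorem homSubst_apply (n : ℕ) (a b : S) (p : R[X]) :
    homSubst n a b p = MvPolynomial.aeval ![a, b] (p.homogenize n) := rfl

theorem homSubst_eq_sum (n : ℕ) (a b : S) (p : R[X]) :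
    homSubst n a b p =
      ∑ i ∈ Finset.range (n + 1), algebraMap R S (p.coeff i) * (a ^ i * b ^ (n - i)) := by
  simp only [homSubst_apply, homogenize, map_sum, MvPolynomial.aeval_monomial,
    Finset.Nat.sum_antidiagonal_eq_sum_range_succ_mk]
  refine Finset.sum_congr rfl fun i _ ↦ ?_
  congr 1
  rw [Finsupp.update_eq_add_single (by simp), Finsupp.prod_add_index' (by simp)
    (by intros; rw [pow_add])]
  simp

theorem homSubst_mul {p q : R[X]} {m n : ℕ} (a b : S) (hp : p.natDegree ≤ m)
    (hq : q.natDegree ≤ n) :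
    homSubst (m + n) a b (p * q) = homSubst m a b p * homSubst n a b q := by
  simp only [homSubst_apply, homogenize_mul p q hp hq, map_mul]

theorem homSubst_C (n : ℕ) (a b : S) (c : R) :
    homSubst n a b (C c) = algebraMap R S c * b ^ n := by
  simp [homSubst_apply]

theorem homSubst_C_mul (n : ℕ) (a b : S) (c : R) (p : R[X]) :
    homSubst n a b (C c * p) = algebraMap R S c * homSubst n a b p := by
  simp [homSubst_apply]

theorem homSubst_one_X (a b : S) : homSubst 1 a b (X : R[X]) = a := by
  simp [homSubst_apply, homogenize_X]

theorem homSubst_pow {p : R[X]} {m : ℕ} (n : ℕ) (a b : S) (hp : p.natDegree ≤ m) :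
    homSubst (m * n) a b (p ^ n) = homSubst m a b p ^ n := by
  induction n with
  | zero => simp [homSubst_apply]
  | succ n ih =>
    rw [pow_succ, mul_add, mul_one, homSubst_mul a b _ hp, ih, pow_succ]
    exact (natDegree_pow_le_of_le n hp).trans (mul_comm n m).le

theorem homSubst_mul_mul (n : ℕ) (a b c : S) (p : R[X]) :
    homSubst n (c * a) (c * b) p = c ^ n * homSubst n a b p := by
  simp only [homSubst_eq_sum, Finset.mul_sum]
  refine Finset.sum_congr rfl fun i hi ↦ ?_
  have : c ^ n = c ^ i * c ^ (n - i) := by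
    rw [← pow_add, Nat.add_sub_cancel' (Nat.lt_succ_iff.mp (Finset.mem_range.mp hi))]
  rw [mul_pow, mul_pow, this]
  ring

theorem homSubst_add_of_natDegree_le {p : R[X]} {m : ℕ} (n : ℕ) (a b : S)
    (hp : p.natDegree ≤ m) : homSubst (m + n) a b p = homSubst m a b p * b ^ n := by
  have := homSubst_mul (n := n) a b hp (natDegree_one.le.trans (Nat.zero_le n))
  rw [mul_one] at this
  rw [this, ← C_1, homSubst_C, map_one, one_mul]

theorem map_homSubst {T : Type*} [CommRing T] [Algebra R T] (f : S →ₐ[R] T) (n : ℕ) (a b : S)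
    (p : R[X]) : f (homSubst n a b p) = homSubst n (f a) (f b) p := by
  simp [homSubst_eq_sum]

theorem homSubst_map_algebraMap {T : Type*} [CommRing T] [Algebra R T] [Algebra S T]
    [IsScalarTower R S T] (n : ℕ) (a b : T) (p : R[X]) :
    homSubst n a b (p.map (algebraMap R S)) = homSubst n a b p := by
  simp [homSubst_eq_sum, ← IsScalarTower.algebraMap_apply]

theorem map_homSubst_polynomial {T : Type*} [CommRing T] (f : R →+* T) (n : ℕ) (a b p : R[X]) :
    (homSubst n a b p).map f = homSubst n (a.map f) (b.map f) (p.map f) := by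
  simp [homSubst_eq_sum, Polynomial.map_sum]

theorem natDegree_homSubst_le {A B : R[X]} {d : ℕ} (n : ℕ) (p : R[X]) (hA : A.natDegree ≤ d)
    (hB : B.natDegree ≤ d) : (homSubst n A B p).natDegree ≤ d * n := by
  rw [homSubst_eq_sum]
  refine natDegree_sum_le_of_forall_le _ _ fun i hi ↦ ?_
  have hi' : i + (n - i) = n := Nat.add_sub_cancel' (Nat.lt_succ_iff.mp (Finset.mem_range.mp hi))
  refine (natDegree_C_mul_le _ _).trans (natDegree_mul_le.trans ?_)
  calc _ ≤ i * d + (n - i) * d :=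
        add_le_add (natDegree_pow_le_of_le _ hA) (natDegree_pow_le_of_le _ hB)
    _ = d * n := by rw [← add_mul, hi', mul_comm]

/-- Substituting a monic `A` of degree `d` and `B` of smaller degree keeps the top coefficient. -/
theorem coeff_homSubst {A B : R[X]} {d : ℕ} (n : ℕ) (p : R[X]) (hA : A.natDegree ≤ d)
    (hA1 : A.coeff d = 1) (hB : B.natDegree < d) :
    (homSubst n A B p).coeff (d * n) = p.coeff n := by
  rw [homSubst_eq_sum, Finset.sum_range_succ, coeff_add, finsetSum_coeff, Finset.sum_eq_zero,
    zero_add]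
  · have h := coeff_pow_of_natDegree_le (m := n) hA
    rw [← C_eq_algebraMap, coeff_C_mul, Nat.sub_self, pow_zero, mul_one, mul_comm d n, h, hA1,
      one_pow, mul_one]
  · intro i hi
    have hi' : i < n := Finset.mem_range.mp hi
    apply coeff_eq_zero_of_natDegree_lt
    refine (natDegree_C_mul_le _ _).trans_lt (natDegree_mul_le.trans_lt ?_)
    calc _ ≤ i * d + (n - i) * B.natDegree :=
          add_le_add (natDegree_pow_le_of_le _ hA) (natDegree_pow_le_of_le _ le_rfl)
      _ < i * d + (n - i) * d := by gcongr; omega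
      _ = d * n := by rw [← add_mul, Nat.add_sub_cancel' hi'.le, mul_comm]

end HomSubst

theorem homSubst_eq_eval_div {k L : Type*} [Field k] [Field L] [Algebra k L] {p : k[X]} {n : ℕ}
    (hp : p.natDegree ≤ n) (a : L) {b : L} (hb : b ≠ 0) :
    homSubst n a b p = aeval (a / b) p * b ^ n := by
  have := eval_homogenize (p := p.map (algebraMap k L)) ((natDegree_map_le).trans hp) ![a, b] hb
  rw [eval_map_algebraMap] at this
  rw [← homSubst_map_algebraMap (S := L)]
  exact this

/-! ### Coprime pairs of forms -/

/-- The forms of degrees `i` and `j` given by `a` and `b` have no common zero on the projective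
line over an algebraic closure. -/
def FormCoprime {k : Type*} [Field k] (i j : ℕ) (a b : k[X]) : Prop :=
  a.natDegree ≤ i ∧ b.natDegree ≤ j ∧ IsCoprime a b ∧ (a.coeff i ≠ 0 ∨ b.coeff j ≠ 0)

section FormCoprime

variable {k : Type*} [Field k]

theorem FormCoprime.symm {i j : ℕ} {a b : k[X]} (h : FormCoprime i j a b) :
    FormCoprime j i b a :=
  ⟨h.2.1, h.1, h.2.2.1.symm, h.2.2.2.symm⟩

theorem FormCoprime.isCoprime_homSubst {i j : ℕ} {p q A B : k[X]} (h : FormCoprime i j p q)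
    (hAB : IsCoprime A B) : IsCoprime (homSubst i A B p) (homSubst j A B q) := by
  obtain ⟨hp, hq, hpq, hc⟩ := h
  rw [isCoprime_iff_aeval_ne_zero_of_isAlgClosed _ (AlgebraicClosure k)] at hAB hpq ⊢
  intro x
  rw [map_homSubst, map_homSubst]
  by_cases hB : aeval x B = 0
  · have hA : aeval x A ≠ 0 := (hAB x).resolve_right (by simpa using hB)
    have key (n : ℕ) (r : k[X]) : homSubst n (aeval x A) (0 : AlgebraicClosure k) r =
        algebraMap k _ (r.coeff n) * aeval x A ^ n := by
      rw [homSubst_eq_sum, Finset.sum_range_succ, Finset.sum_eq_zero, zero_add]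
      · simp
      · intro m hm
        rw [zero_pow (by have := Finset.mem_range.mp hm; omega)]
        simp
    rw [hB, key, key]
    exact hc.imp (fun h ↦ by simp [h, hA]) (fun h ↦ by simp [h, hA])
  · rw [homSubst_eq_eval_div hp _ hB, homSubst_eq_eval_div hq _ hB]
    exact (hpq (aeval x A / aeval x B)).imp (fun h ↦ by simp [h, hB]) (fun h ↦ by simp [h, hB])

theorem isCoprime_of_isCoprime_homSubst {i j d : ℕ} {p q A B : k[X]} (hp : p.natDegree ≤ i)
    (hq : q.natDegree ≤ j) (hA : A.natDegree ≤ d) (hA1 : A.coeff d = 1) (hB : B.natDegree < d)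
    (hij : p ≠ 0 ∨ q ≠ 0)
    (h : IsCoprime (homSubst i A B p) (homSubst j A B q)) : IsCoprime p q := by
  classical
  have hg0 : gcd p q ≠ 0 := by
    rw [Ne, gcd_eq_zero_iff]; tauto
  have key (i : ℕ) (p : k[X]) (hp : p.natDegree ≤ i) (g : k[X]) (hd : g ∣ p) :
      homSubst g.natDegree A B g ∣ homSubst i A B p := by
    rcases eq_or_ne p 0 with rfl | hp0
    · simp
    obtain ⟨r, rfl⟩ := hd
    obtain ⟨hg, hr⟩ := mul_ne_zero_iff.mp hp0
    rw [natDegree_mul hg hr] at hp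
    obtain ⟨e, rfl⟩ := Nat.exists_eq_add_of_le hp
    rw [add_assoc, homSubst_mul A B le_rfl (Nat.le_add_right _ _)]
    exact dvd_mul_right _ _
  have hu := h.isUnit_of_dvd' (key i p hp _ (gcd_dvd_left p q)) (key j q hq _ (gcd_dvd_right p q))
  have hc := coeff_homSubst (gcd p q).natDegree (gcd p q) hA hA1 hB
  have hdeg : (gcd p q).natDegree = 0 := by
    by_contra hne
    rw [coeff_natDegree, coeff_eq_zero_of_natDegree_lt] at hc
    · exact hg0 (leadingCoeff_eq_zero.mp hc.symm)
    · rw [natDegree_eq_zero_of_isUnit hu]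
      exact Nat.mul_pos (by omega) (Nat.pos_of_ne_zero hne)
  rw [← gcd_isUnit_iff]
  exact isUnit_iff_degree_eq_zero.mpr (by rw [degree_eq_natDegree hg0, hdeg]; rfl)

end FormCoprime

/-! ### Pencils of binary forms and intermediate fields -/

/-- A base point free pencil of binary forms of degree `n`, in dehomogenized form. -/
def IsPencil {k : Type*} [Field k] (n : ℕ) (W : Submodule k k[X]) : Prop :=
  ∃ P Q, FormCoprime n n P Q ∧ W = Submodule.span k {P, Q}

section Pencil

variable {k : Type*} [Field k] {n : ℕ}

theorem mem_span_pair_iff {P Q R : k[X]} :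
    R ∈ Submodule.span k {P, Q} ↔ ∃ x y : k, C x * P + C y * Q = R := by
  simp [Submodule.mem_span_pair, smul_eq_C_mul]

theorem FormCoprime.eq_zero_of_add_eq_zero (hn : 1 ≤ n) {P Q : k[X]} (h : FormCoprime n n P Q)
    {x y : k} (hxy : C x * P + C y * Q = 0) : x = 0 ∧ y = 0 := by
  have aux {P Q : k[X]} (h : FormCoprime n n P Q) {x y : k} (hxy : C x * P + C y * Q = 0) :
      x = 0 := by
    by_contra hx
    obtain ⟨-, -, hc, hn'⟩ := h
    have hP : P = C (-(x⁻¹ * y)) * Q := by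
      have : C x⁻¹ * (C x * P + C y * Q) = P + C (x⁻¹ * y) * Q := by
        rw [mul_add, ← mul_assoc, ← C_mul, inv_mul_cancel₀ hx, C_1, one_mul, ← mul_assoc, ← C_mul]
      rw [hxy, mul_zero] at this
      rw [C_neg]
      linear_combination -this
    have hQ : IsUnit Q := hc.isUnit_of_dvd' ⟨_, by rw [hP, mul_comm]⟩ dvd_rfl
    obtain ⟨c, -, rfl⟩ := isUnit_iff.mp hQ
    rw [hP, ← C_mul, coeff_C, coeff_C, if_neg (by omega), if_neg (by omega)] at hn'
    simp at hn'
  exact ⟨aux h hxy, aux h.symm (by rw [add_comm]; exact hxy)⟩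

theorem FormCoprime.linearIndependent (hn : 1 ≤ n) {P Q : k[X]} (h : FormCoprime n n P Q) :
    LinearIndependent k ![P, Q] := by
  rw [LinearIndependent.pair_iff]
  intro x y hxy
  exact h.eq_zero_of_add_eq_zero hn (by simpa [smul_eq_C_mul] using hxy)

theorem IsPencil.finrank_eq (hn : 1 ≤ n) {W : Submodule k k[X]} (h : IsPencil n W) :
    Module.finrank k W = 2 := by
  obtain ⟨P, Q, hPQ, rfl⟩ := h
  have := finrank_span_eq_card (hPQ.linearIndependent hn)
  rwa [Matrix.range_cons_cons_empty] at this

theorem IsPencil.eq_of_le (hn : 1 ≤ n) {W W' : Submodule k k[X]} (h : IsPencil n W)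
    (h' : IsPencil n W') (hle : W ≤ W') : W = W' := by
  have : FiniteDimensional k W' := by
    obtain ⟨P, Q, -, rfl⟩ := h'
    exact FiniteDimensional.span_of_finite k (by simp)
  exact Submodule.eq_of_le_of_finrank_eq hle (by rw [h.finrank_eq hn, h'.finrank_eq hn])

theorem FormCoprime.ne_zero_right (hn : 1 ≤ n) {P Q : k[X]} (h : FormCoprime n n P Q) : Q ≠ 0 := by
  rintro rfl
  simpa using h.eq_zero_of_add_eq_zero hn (x := 0) (y := 1) (by simp)

theorem IsPencil.natDegree_le {W : Submodule k k[X]} (h : IsPencil n W) {w : k[X]} (hw : w ∈ W) :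
    w.natDegree ≤ n := by
  obtain ⟨P, Q, ⟨hP, hQ, -⟩, rfl⟩ := h
  obtain ⟨x, y, rfl⟩ := mem_span_pair_iff.mp hw
  exact natDegree_add_le_of_degree_le ((natDegree_C_mul_le _ _).trans hP)
    ((natDegree_C_mul_le _ _).trans hQ)

end Pencil

section RatFuncPencil

open IntermediateField

variable {k : Type*} [Field k] {n : ℕ}

local notation "ι" => algebraMap k[X] (RatFunc k)

theorem ratFunc_C_eq (c : k) : ι (C c) = algebraMap k (RatFunc k) c := by
  rw [IsScalarTower.algebraMap_apply k k[X] (RatFunc k), algebraMap_eq]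

theorem formCoprime_num_denom (f : RatFunc k) (hn : 1 ≤ n)
    (hf : max f.num.natDegree f.denom.natDegree = n) : FormCoprime n n f.num f.denom := by
  refine ⟨hf ▸ le_max_left _ _, hf ▸ le_max_right _ _, f.isCoprime_num_denom, ?_⟩
  rcases max_choice f.num.natDegree f.denom.natDegree with h | h
  · left
    rw [← hf, h, coeff_natDegree]
    intro h0
    rw [leadingCoeff_eq_zero] at h0
    rw [h, h0, natDegree_zero] at hf
    omega
  · right
    rw [← hf, h, coeff_natDegree]
    exact leadingCoeff_ne_zero.mpr f.denom_ne_zero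

theorem exists_mul_num_denom (f : RatFunc k) {P Q : k[X]} (hQ0 : Q ≠ 0) (h : f = ι P / ι Q) :
    ∃ w, P = f.num * w ∧ Q = f.denom * w := by
  have hQ0' : ι Q ≠ 0 := by simpa using hQ0
  have hd0' : ι f.denom ≠ 0 := by simpa using f.denom_ne_zero
  have hmul : f.num * Q = P * f.denom := by
    have h1 : ι f.num / ι f.denom = ι P / ι Q := by rw [RatFunc.num_div_denom, h]
    rw [div_eq_div_iff hd0' hQ0', ← map_mul, ← map_mul] at h1
    exact RatFunc.algebraMap_injective k h1
  obtain ⟨w, rfl⟩ : f.denom ∣ Q :=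
    f.isCoprime_num_denom.symm.dvd_of_dvd_mul_left ⟨P, by rw [hmul, mul_comm]⟩
  refine ⟨w, mul_right_cancel₀ f.denom_ne_zero ?_, rfl⟩
  rw [← hmul]; ring

theorem exists_C_mul_num_denom (f : RatFunc k) (hf : max f.num.natDegree f.denom.natDegree = n)
    {P Q : k[X]} (hP : P.natDegree ≤ n) (hQ : Q.natDegree ≤ n) (hQ0 : Q ≠ 0)
    (h : f = ι P / ι Q) : ∃ c : k, c ≠ 0 ∧ P = C c * f.num ∧ Q = C c * f.denom := by
  obtain ⟨w, hPw, rfl⟩ := exists_mul_num_denom f hQ0 h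
  have hw : w ≠ 0 := right_ne_zero_of_mul hQ0
  have hw0 : w.natDegree = 0 := by
    rw [natDegree_mul f.denom_ne_zero hw] at hQ
    rcases max_choice f.num.natDegree f.denom.natDegree with h | h
    · rcases eq_or_ne f.num 0 with h0 | h0
      · rw [h0, natDegree_zero] at h hf
        omega
      · rw [hPw, natDegree_mul h0 hw] at hP
        omega
    · omega
  obtain ⟨c, rfl⟩ : ∃ c, w = C c := ⟨_, eq_C_of_natDegree_eq_zero hw0⟩
  exact ⟨c, by simpa using hw, by rw [hPw, mul_comm], mul_comm _ _⟩

theorem FormCoprime.max_natDegree_num_denom (hn : 1 ≤ n) {P Q : k[X]} (h : FormCoprime n n P Q) :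
    max (ι P / ι Q).num.natDegree (ι P / ι Q).denom.natDegree = n := by
  obtain ⟨w, hP, hQ⟩ := exists_mul_num_denom (ι P / ι Q) (h.ne_zero_right hn) rfl
  have hw : IsUnit w := h.2.2.1.isUnit_of_dvd' ⟨_, by rw [mul_comm]; exact hP⟩
    ⟨_, by rw [mul_comm]; exact hQ⟩
  obtain ⟨c, hc, rfl⟩ := isUnit_iff.mp hw
  have hc0 : c ≠ 0 := hc.ne_zero
  have hPd : P.natDegree = (ι P / ι Q).num.natDegree := by
    conv_lhs => rw [hP, natDegree_mul_C hc0]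
  have hQd : Q.natDegree = (ι P / ι Q).denom.natDegree := by
    conv_lhs => rw [hQ, natDegree_mul_C hc0]
  rw [← hPd, ← hQd]
  refine le_antisymm (max_le h.1 h.2.1) ?_
  exact le_max_iff.mpr (h.2.2.2.imp le_natDegree_of_ne_zero le_natDegree_of_ne_zero)

/-- The numerator and denominator of a generator of the field `K`. -/
noncomputable def pencilOf (K : IntermediateField k (RatFunc k)) : Submodule k k[X] :=
  Submodule.span k {(RatFunc.Luroth.generator K).num, (RatFunc.Luroth.generator K).denom}

theorem max_natDegree_generator (K : IntermediateField k (RatFunc k))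
    (hK : Module.finrank K (RatFunc k) = n) :
    max (RatFunc.Luroth.generator K).num.natDegree
      (RatFunc.Luroth.generator K).denom.natDegree = n := by
  rw [← hK, ← RatFunc.finrank_eq_max_natDegree, ← RatFunc.Luroth.eq_adjoin_generator]

theorem isPencil_pencilOf (hn : 1 ≤ n) (K : IntermediateField k (RatFunc k))
    (hK : Module.finrank K (RatFunc k) = n) : IsPencil n (pencilOf K) :=
  ⟨_, _, formCoprime_num_denom _ hn (max_natDegree_generator K hK), rfl⟩

theorem div_mem_of_mem_pencilOf (K : IntermediateField k (RatFunc k)) {P Q : k[X]}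
    (hP : P ∈ pencilOf K) (hQ : Q ∈ pencilOf K) : ι P / ι Q ∈ K := by
  set g := RatFunc.Luroth.generator K with hg
  have hd0' : ι g.denom ≠ 0 := by simpa using g.denom_ne_zero
  have key {R : k[X]} (hR : R ∈ pencilOf K) : ι R / ι g.denom ∈ K := by
    obtain ⟨x, y, rfl⟩ := mem_span_pair_iff.mp hR
    rw [map_add, map_mul, map_mul, add_div, mul_div_assoc, mul_div_assoc, RatFunc.num_div_denom,
      div_self hd0', mul_one, ratFunc_C_eq, ratFunc_C_eq]
    exact add_mem (mul_mem (K.algebraMap_mem _) RatFunc.Luroth.generator_mem)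
      (K.algebraMap_mem _)
  rw [← div_div_div_cancel_right₀ hd0']
  exact div_mem (key hP) (key hQ)

theorem mem_pencilOf_of_adjoin_eq (hn : 1 ≤ n) (K : IntermediateField k (RatFunc k))
    (hK : Module.finrank K (RatFunc k) = n) {P Q : k[X]} (hP : P.natDegree ≤ n)
    (hQ : Q.natDegree ≤ n) (hQ0 : Q ≠ 0) (h : k⟮ι P / ι Q⟯ = K) :
    P ∈ pencilOf K ∧ Q ∈ pencilOf K := by
  have hbot : K ≠ ⊥ := by
    rintro rfl
    rw [IntermediateField.finrank_bot', Module.finrank_of_not_finite] at hK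
    · omega
    · intro H
      exact Algebra.transcendental_iff_not_isAlgebraic.mp RatFunc.transcendental
        (Algebra.IsAlgebraic.of_finite k (RatFunc k))
  set g := RatFunc.Luroth.generator K with hg
  have hd0' : ι g.denom ≠ 0 := by simpa using g.denom_ne_zero
  have hfK : ι P / ι Q ∈ K := h ▸ mem_adjoin_simple_self k _
  obtain ⟨u, hu⟩ := (RatFunc.Luroth.algEquiv hbot).surjective ⟨_, hfK⟩
  have hu' : k⟮u⟯ = ⊤ := by
    have hcomp : (K.val.comp (RatFunc.Luroth.algEquiv hbot).toAlgHom) u = ι P / ι Q :=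
      congrArg Subtype.val hu
    apply IntermediateField.map_injective
      (K.val.comp (RatFunc.Luroth.algEquiv hbot).toAlgHom)
    rw [adjoin_map, Set.image_singleton, hcomp, h, ← AlgHom.fieldRange_eq_map]
    ext x
    constructor
    · intro hx
      obtain ⟨v, hv⟩ := (RatFunc.Luroth.algEquiv hbot).surjective ⟨x, hx⟩
      exact ⟨v, congrArg Subtype.val hv⟩
    · rintro ⟨v, rfl⟩
      exact (RatFunc.Luroth.algEquiv hbot v).2
  have hdeg : max u.num.natDegree u.denom.natDegree = 1 := by
    rw [← RatFunc.finrank_eq_max_natDegree, hu', IntermediateField.finrank_top]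
  have hg1 := formCoprime_num_denom g hn (max_natDegree_generator K hK)
  have hf : ι P / ι Q = ι (C (u.num.coeff 1) * g.num + C (u.num.coeff 0) * g.denom) /
      ι (C (u.denom.coeff 1) * g.num + C (u.denom.coeff 0) * g.denom) := by
    have aux (p : k[X]) (hp : p.natDegree ≤ 1) :
        aeval g p = ι (C (p.coeff 1) * g.num + C (p.coeff 0) * g.denom) / ι g.denom := by
      conv_lhs => rw [eq_X_add_C_of_natDegree_le_one hp]
      have hr : ι (C (p.coeff 1) * g.num + C (p.coeff 0) * g.denom) / ι g.denom =
          algebraMap k _ (p.coeff 1) * g + algebraMap k _ (p.coeff 0) := by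
        conv_rhs => rw [← RatFunc.num_div_denom g]
        rw [map_add, map_mul, map_mul, add_div, mul_div_assoc, mul_div_assoc,
          div_self hd0', mul_one, ratFunc_C_eq, ratFunc_C_eq]
      rw [hr, map_add, map_mul, aeval_C, aeval_C, aeval_X]
    have h1 : ι P / ι Q = (RatFunc.Luroth.algEquiv hbot u : RatFunc k) := by rw [hu]
    rw [h1, RatFunc.Luroth.algEquiv_apply, ← hg, aux _ (hdeg ▸ le_max_left _ _),
      aux _ (hdeg ▸ le_max_right _ _), div_div_div_cancel_right₀ hd0']
  have hne : C (u.denom.coeff 1) * g.num + C (u.denom.coeff 0) * g.denom ≠ 0 := by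
    intro h0
    obtain ⟨h1, h2⟩ := hg1.eq_zero_of_add_eq_zero hn h0
    apply u.denom_ne_zero
    have hd1 : u.denom.natDegree ≤ 1 := hdeg ▸ le_max_right _ _
    rw [eq_X_add_C_of_natDegree_le_one hd1, h1, h2]
    simp
  have hfn : max (ι P / ι Q).num.natDegree (ι P / ι Q).denom.natDegree = n := by
    rw [← RatFunc.finrank_eq_max_natDegree, h, hK]
  have hle (x y : k) : (C x * g.num + C y * g.denom).natDegree ≤ n :=
    (isPencil_pencilOf hn K hK).natDegree_le (mem_span_pair_iff.mpr ⟨x, y, rfl⟩)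
  obtain ⟨c, hc, hc1, hc2⟩ := exists_C_mul_num_denom _ hfn hP hQ hQ0 rfl
  obtain ⟨e, he, he1, he2⟩ := exists_C_mul_num_denom _ hfn (hle _ _) (hle _ _) hne hf
  have key {R S T : k[X]} (hR : R = C c * S) (hT : T = C e * S) (hTK : T ∈ pencilOf K) :
      R ∈ pencilOf K := by
    have : R = (c * e⁻¹) • T := by
      rw [hR, hT, smul_eq_C_mul, ← mul_assoc, ← C_mul, mul_assoc, inv_mul_cancel₀ he, mul_one]
    rw [this]
    exact Submodule.smul_mem _ _ hTK
  exact ⟨key hc1 he1 (mem_span_pair_iff.mpr ⟨_, _, rfl⟩),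
    key hc2 he2 (mem_span_pair_iff.mpr ⟨_, _, rfl⟩)⟩

theorem pencilOf_adjoin (hn : 1 ≤ n) {P Q : k[X]} (h : FormCoprime n n P Q) :
    Module.finrank k⟮ι P / ι Q⟯ (RatFunc k) = n ∧
      pencilOf k⟮ι P / ι Q⟯ = Submodule.span k {P, Q} := by
  have hK : Module.finrank k⟮ι P / ι Q⟯ (RatFunc k) = n := by
    rw [RatFunc.finrank_eq_max_natDegree, h.max_natDegree_num_denom hn]
  refine ⟨hK, ((IsPencil.eq_of_le hn ⟨P, Q, h, rfl⟩ (isPencil_pencilOf hn _ hK) ?_)).symm⟩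
  obtain ⟨h1, h2⟩ := mem_pencilOf_of_adjoin_eq hn _ hK h.1 h.2.1 (h.ne_zero_right hn) rfl
  rw [Submodule.span_le]
  rintro x (rfl | rfl)
  exacts [h1, h2]

theorem le_of_pencilOf_le {K K' : IntermediateField k (RatFunc k)}
    (h : pencilOf K ≤ pencilOf K') : K ≤ K' := by
  rw [RatFunc.Luroth.eq_adjoin_generator (E := K), adjoin_simple_le_iff,
    ← RatFunc.num_div_denom (RatFunc.Luroth.generator K)]
  exact div_mem_of_mem_pencilOf K' (h (Submodule.subset_span (by simp)))
    (h (Submodule.subset_span (by simp)))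

theorem algEquiv_algebraMap_eq (σ : RatFunc k ≃ₐ[k] RatFunc k) {A B : k[X]} (hB : B ≠ 0)
    (hσ : σ RatFunc.X = ι A / ι B) {P : k[X]} (hP : P.natDegree ≤ n) :
    σ (ι P) = ι (homSubst n A B P) / ι B ^ n := by
  have hB' : ι B ≠ 0 := by simpa using hB
  have h1 : ι (homSubst n A B P) = homSubst n (ι A) (ι B) P :=
    map_homSubst (IsScalarTower.toAlgHom k k[X] (RatFunc k)) n A B P
  rw [h1, homSubst_eq_eval_div hP _ hB', mul_div_cancel_right₀ _ (pow_ne_zero _ hB'), ← hσ,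
    ← RatFunc.aeval_X_left_eq_algebraMap]
  exact (Polynomial.aeval_algHom_apply σ.toAlgHom RatFunc.X P).symm

theorem finrank_map_algEquiv (σ : RatFunc k ≃ₐ[k] RatFunc k)
    (K : IntermediateField k (RatFunc k)) :
    Module.finrank (K.map σ.toAlgHom) (RatFunc k) = Module.finrank K (RatFunc k) := by
  have := IntermediateField.relfinrank_map_map K ⊤ σ.toAlgHom
  rw [← AlgHom.fieldRange_eq_map, AlgHom.fieldRange_eq_top.mpr σ.surjective] at this
  simpa using this

theorem map_eq_iff_pencilOf (hn : 1 ≤ n) (σ : RatFunc k ≃ₐ[k] RatFunc k) {A B : k[X]}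
    (hA : A.natDegree ≤ 1) (hB1 : B.natDegree ≤ 1) (hB : B ≠ 0)
    (hσ : σ RatFunc.X = ι A / ι B) (K : IntermediateField k (RatFunc k))
    (hK : Module.finrank K (RatFunc k) = n) :
    K.map σ.toAlgHom = K ↔ ∀ w ∈ pencilOf K, homSubst n A B w ∈ pencilOf K := by
  set g := RatFunc.Luroth.generator K with hg
  have hB' : ι B ≠ 0 := by simpa using hB
  have hpen := isPencil_pencilOf hn K hK
  have hNd : g.num.natDegree ≤ n := hpen.natDegree_le (Submodule.subset_span (by simp [hg]))
  have hDd : g.denom.natDegree ≤ n := hpen.natDegree_le (Submodule.subset_span (by simp [hg]))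
  have hσg : σ g = ι (homSubst n A B g.num) / ι (homSubst n A B g.denom) := by
    conv_lhs => rw [← RatFunc.num_div_denom g]
    rw [map_div₀, algEquiv_algebraMap_eq σ hB hσ hNd, algEquiv_algebraMap_eq σ hB hσ hDd,
      div_div_div_cancel_right₀ (pow_ne_zero _ hB')]
  have hD0 : homSubst n A B g.denom ≠ 0 := by
    intro h0
    have := algEquiv_algebraMap_eq σ hB hσ hDd
    rw [h0, map_zero, zero_div, map_eq_zero_iff _ σ.injective] at this
    exact g.denom_ne_zero (by simpa using this)
  have hmap : K.map σ.toAlgHom =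
      k⟮ι (homSubst n A B g.num) / ι (homSubst n A B g.denom)⟯ := by
    conv_lhs => rw [RatFunc.Luroth.eq_adjoin_generator (E := K)]
    rw [adjoin_map, Set.image_singleton, ← hσg]
    rfl
  constructor
  · intro h w hw
    rw [hmap] at h
    obtain ⟨h1, h2⟩ := mem_pencilOf_of_adjoin_eq hn K hK
      ((natDegree_homSubst_le n _ hA hB1).trans (one_mul n).le)
      ((natDegree_homSubst_le n _ hA hB1).trans (one_mul n).le) hD0 h
    obtain ⟨x, y, rfl⟩ := mem_span_pair_iff.mp hw
    rw [map_add, homSubst_C_mul, homSubst_C_mul, ← C_eq_algebraMap, ← C_eq_algebraMap,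
      ← smul_eq_C_mul, ← smul_eq_C_mul]
    exact add_mem (Submodule.smul_mem _ _ h1) (Submodule.smul_mem _ _ h2)
  · intro h
    have hle : K.map σ.toAlgHom ≤ K := by
      rw [hmap, adjoin_simple_le_iff]
      exact div_mem_of_mem_pencilOf K (h _ (Submodule.subset_span (by simp [hg])))
        (h _ (Submodule.subset_span (by simp [hg])))
    have : FiniteDimensional (K.map σ.toAlgHom) (RatFunc k) :=
      Module.finite_of_finrank_pos (by rw [finrank_map_algEquiv, hK]; omega)
    exact IntermediateField.eq_of_le_of_finrank_eq' hle (finrank_map_algEquiv σ K)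

/-- Fields of codegree `n` fixed by a Möbius automorphism correspond to the pencils of degree `n`
that are stable under the corresponding substitution. -/
theorem card_fixed_eq_card_stable_pencil (hn : 1 ≤ n) (σ : RatFunc k ≃ₐ[k] RatFunc k) {A B : k[X]}
    (hA : A.natDegree ≤ 1) (hB1 : B.natDegree ≤ 1) (hB : B ≠ 0)
    (hσ : σ RatFunc.X = ι A / ι B) :
    Nat.card {K : IntermediateField k (RatFunc k) //
        Module.finrank K (RatFunc k) = n ∧ K.map σ.toAlgHom = K} =
      Nat.card {W : Submodule k k[X] // IsPencil n W ∧ ∀ w ∈ W, homSubst n A B w ∈ W} := by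
  refine Nat.card_congr (Equiv.ofBijective (fun K ↦ ⟨pencilOf K.1, isPencil_pencilOf hn _ K.2.1,
    (map_eq_iff_pencilOf hn σ hA hB1 hB hσ K.1 K.2.1).mp K.2.2⟩) ⟨fun K K' h ↦ ?_, ?_⟩)
  · have h' : pencilOf K.1 = pencilOf K'.1 := congrArg Subtype.val h
    exact Subtype.ext (le_antisymm (le_of_pencilOf_le h'.le) (le_of_pencilOf_le h'.ge))
  · rintro ⟨W, ⟨P, Q, hPQ, rfl⟩, hW⟩
    obtain ⟨h1, h2⟩ := pencilOf_adjoin hn hPQ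
    refine ⟨⟨k⟮ι P / ι Q⟯, h1, ?_⟩, Subtype.ext h2⟩
    rw [map_eq_iff_pencilOf hn σ hA hB1 hB hσ _ h1, h2]
    exact hW

end RatFuncPencil

/-! ### The eigenvectors of the substitution `X ↦ ((α + β) X - α β) / X` -/

section Mobius

variable {E : Type*} [Field E]

/-- The action on forms of degree `n` of the homography with fixed points `α` and `β`
which sends `∞` to `α + β`. -/
noncomputable def mob (α β : E) (n : ℕ) : E[X] →ₗ[E] E[X] :=
  homSubst n (C (α + β) * X - C (α * β)) X

variable {α β : E}

theorem mob_comm (α β : E) (n : ℕ) : mob α β n = mob β α n := by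
  rw [mob, mob, add_comm, mul_comm β]

theorem natDegree_linear_le (s t : E) : (C s * X - C t).natDegree ≤ 1 := by
  compute_degree

theorem mob_mul {p q : E[X]} {m n : ℕ} (hp : p.natDegree ≤ m) (hq : q.natDegree ≤ n) :
    mob α β (m + n) (p * q) = mob α β m p * mob α β n q :=
  homSubst_mul _ _ hp hq

theorem mob_C_mul (n : ℕ) (c : E) (p : E[X]) : mob α β n (C c * p) = C c * mob α β n p := by
  rw [mob, homSubst_C_mul, ← C_eq_algebraMap]

theorem mob_one_X_sub_C : mob α β 1 (X - C α) = C β * (X - C α) := by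
  rw [map_sub, mob, homSubst_one_X, homSubst_C, ← C_eq_algebraMap, pow_one]
  simp only [C_add, C_mul]
  ring

theorem mob_X_sub_C_mul {n : ℕ} {p : E[X]} (hp : p.natDegree ≤ n) :
    mob α β (n + 1) ((X - C α) * p) = C β * ((X - C α) * mob α β n p) := by
  rw [add_comm, mob_mul (natDegree_X_sub_C_le α) hp, mob_one_X_sub_C, mul_assoc]

theorem mob_X_sub_C_pow (n : ℕ) : mob α β n ((X - C α) ^ n) = C (β ^ n) * (X - C α) ^ n := by
  have := homSubst_pow n (C (α + β) * X - C (α * β)) X (natDegree_X_sub_C_le α)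
  rw [one_mul] at this
  rw [mob, this]
  change mob α β 1 (X - C α) ^ n = _
  rw [mob_one_X_sub_C, mul_pow, C_pow]

theorem mob_X_sub_C_pow' (n : ℕ) : mob α β n ((X - C β) ^ n) = C (α ^ n) * (X - C β) ^ n := by
  rw [mob_comm, mob_X_sub_C_pow]

theorem eval_mob (hα : α ≠ 0) {n : ℕ} {p : E[X]} (hp : p.natDegree ≤ n) :
    (mob α β n p).eval α = α ^ n * p.eval α := by
  have h := map_homSubst (aeval α) n (C (α + β) * X - C (α * β)) X p
  rw [aeval_X, homSubst_eq_eval_div hp _ hα] at h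
  have h1 : (aeval α (C (α + β) * X - C (α * β))) / α = α := by
    simp only [map_sub, map_mul, aeval_C, aeval_X, Algebra.algebraMap_self, RingHom.id_apply]
    field_simp
    ring
  rw [h1] at h
  rw [← coe_aeval_eq_eval, mob, h, mul_comm]

theorem natDegree_le_of_X_sub_C_mul {a : E} {n : ℕ} {p : E[X]}
    (h : ((X - C a) * p).natDegree ≤ n + 1) : p.natDegree ≤ n := by
  rcases eq_or_ne p 0 with rfl | hp
  · simp
  rw [natDegree_mul (X_sub_C_ne_zero a) hp, natDegree_X_sub_C] at h
  omega

theorem exists_X_sub_C_mul {a : E} {n : ℕ} {p : E[X]} (hp : p.natDegree ≤ n + 1)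
    (h : p.eval a = 0) : ∃ q : E[X], q.natDegree ≤ n ∧ p = (X - C a) * q := by
  obtain ⟨q, rfl⟩ := dvd_iff_isRoot.mpr h
  exact ⟨q, natDegree_le_of_X_sub_C_mul hp, rfl⟩

theorem mob_eq_of_mob_X_sub_C_mul {n : ℕ} {p r : E[X]} (hp : p.natDegree ≤ n)
    (h : mob α β (n + 1) ((X - C α) * p) = C β * ((X - C α) * r)) (hβ : β ≠ 0) :
    mob α β n p = r := by
  rw [mob_X_sub_C_mul hp] at h
  exact mul_left_cancel₀ (X_sub_C_ne_zero α) (mul_left_cancel₀ (C_ne_zero.mpr hβ) h)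

theorem exists_X_sub_C_pow_mul (hα : α ≠ 0) (hβ : β ≠ 0) (c m : ℕ)
    (hc : ∀ i, 0 < i → i ≤ c → α ^ i ≠ β ^ i) {p : E[X]} (hp : p.natDegree ≤ c + m)
    (h : mob α β (c + m) p = C (β ^ c * α ^ m) * p) :
    ∃ q : E[X], q.natDegree ≤ m ∧ p = (X - C α) ^ c * q ∧ mob α β m q = C (α ^ m) * q := by
  induction c generalizing p with
  | zero => rw [zero_add] at *; exact ⟨p, hp, by simp, by simpa using h⟩
  | succ c ih =>
    have h0 : p.eval α = 0 := by
      have h1 := eval_mob (β := β) hα hp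
      rw [h, eval_mul, eval_C] at h1
      have h2 : α ^ m * ((β ^ (c + 1) - α ^ (c + 1)) * p.eval α) = 0 := by
        rw [pow_add α] at h1
        linear_combination h1
      simpa [hα, sub_eq_zero, (hc (c + 1) (Nat.succ_pos c) le_rfl).symm] using h2
    rw [add_right_comm] at hp h
    obtain ⟨q, hq, rfl⟩ := exists_X_sub_C_mul hp h0
    have h1 := mob_eq_of_mob_X_sub_C_mul (r := C (β ^ c * α ^ m) * q) hq
      (by rw [h]; simp only [C_mul, C_pow]; ring) hβ
    obtain ⟨r, hr, rfl, h2⟩ := ih (fun i hi hic ↦ hc i hi (by omega)) hq h1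
    exact ⟨r, hr, by ring, h2⟩

/-- The operator `mob α β n` has no nontrivial Jordan block. -/
theorem mob_semisimple (hα : α ≠ 0) (hβ : β ≠ 0) (hαβ : α ≠ β) (n : ℕ) {l : E} {p r : E[X]}
    (hp : p.natDegree ≤ n) (hr : r.natDegree ≤ n) (h : mob α β n p = C l * p + r)
    (h' : mob α β n r = C l * r) : r = 0 := by
  induction n generalizing l p r with
  | zero =>
    have h1 := eval_mob (β := β) hα hp
    have h2 := eval_mob (β := β) hα hr
    rw [h, eval_add, eval_mul, eval_C, pow_zero, one_mul] at h1
    rw [h', eval_mul, eval_C, pow_zero, one_mul] at h2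
    have h3 : r.eval α ^ 2 = 0 := by linear_combination r.eval α * h1 - p.eval α * h2
    rw [eq_C_of_natDegree_le_zero hr, eval_C] at h3
    rw [eq_C_of_natDegree_le_zero hr, pow_eq_zero_iff two_ne_zero |>.mp h3, C_0]
  | succ n ih =>
    have h1 := eval_mob (β := β) hα hp
    have h2 := eval_mob (β := β) hα hr
    rw [h, eval_add, eval_mul, eval_C] at h1
    rw [h', eval_mul, eval_C] at h2
    have h3 : r.eval α ^ 2 = 0 := by linear_combination r.eval α * h1 - p.eval α * h2
    have hr0 : r.eval α = 0 := pow_eq_zero_iff two_ne_zero |>.mp h3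
    have h4 : (α ^ (n + 1) - l) * p.eval α = 0 := by linear_combination hr0 - h1
    obtain ⟨e, hβe, he⟩ : ∃ e : E, (p - C e * (X - C β) ^ (n + 1)).eval α = 0 ∧
        e * (α ^ (n + 1) - l) = 0 := by
      refine ⟨p.eval α / (α - β) ^ (n + 1), ?_, by rw [div_mul_eq_mul_div, mul_comm, h4, zero_div]⟩
      simp [sub_ne_zero.mpr hαβ]
    have hdeg : (p - C e * (X - C β) ^ (n + 1)).natDegree ≤ n + 1 := by
      refine (natDegree_sub_le _ _).trans (max_le hp ((natDegree_C_mul_le _ _).trans ?_))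
      simp
    have h5 : mob α β (n + 1) (p - C e * (X - C β) ^ (n + 1)) =
        C l * (p - C e * (X - C β) ^ (n + 1)) + r := by
      rw [map_sub, mob_C_mul, mob_X_sub_C_pow', h]
      have : C e * (C (α ^ (n + 1)) - C l) = 0 := by rw [← C_sub, ← C_mul, he, C_0]
      linear_combination - (X - C β) ^ (n + 1) * this
    obtain ⟨q, hq, hqe⟩ := exists_X_sub_C_mul hdeg hβe
    obtain ⟨s, hs, rfl⟩ := exists_X_sub_C_mul hr hr0
    rw [hqe] at h5
    have hC : C β * C (l / β) = C l := by rw [← C_mul, mul_div_cancel₀ _ hβ]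
    have hC' : C β * C (β⁻¹) = 1 := by rw [← C_mul, mul_inv_cancel₀ hβ, C_1]
    have h6 := mob_eq_of_mob_X_sub_C_mul (r := C (l / β) * q + C β⁻¹ * s) hq
      (by rw [h5]; linear_combination -(X - C α) * q * hC - (X - C α) * s * hC') hβ
    have h7 := mob_eq_of_mob_X_sub_C_mul (r := C (l / β) * s) hs
      (by rw [h']; linear_combination -(X - C α) * s * hC) hβ
    have h8 := ih hq ((natDegree_C_mul_le _ _).trans hs) h6 (by rw [mob_C_mul, h7]; ring)
    have : s = 0 := by simpa [hβ] using h8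
    rw [this, mul_zero]

/-- The denominator of the rational function of degree `d` which is invariant under a homography
of order `d` with fixed points `α` and `β`. -/
noncomputable def invDenom (α β : E) (d : ℕ) : E[X] :=
  C (α - β)⁻¹ * ((X - C β) ^ d - (X - C α) ^ d)

/-- The numerator of the rational function of degree `d` which is invariant under a homography
of order `d` with fixed points `α` and `β`. -/
noncomputable def invNum (α β : E) (d : ℕ) : E[X] :=
  (X - C α) ^ d + C α * invDenom α β d

theorem invNum_sub (α β : E) (d : ℕ) :
    invNum α β d - C α * invDenom α β d = (X - C α) ^ d := by
  rw [invNum, add_sub_cancel_right]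

theorem invNum_sub' (hαβ : α ≠ β) (d : ℕ) :
    invNum α β d - C β * invDenom α β d = (X - C β) ^ d := by
  have : (C α - C β) * C (α - β)⁻¹ = 1 := by
    rw [← C_sub, ← C_mul, mul_inv_cancel₀ (sub_ne_zero.mpr hαβ), C_1]
  rw [invNum, invDenom]
  linear_combination ((X - C β) ^ d - (X - C α) ^ d) * this

theorem natDegree_invDenom_lt (α β : E) {d : ℕ} (hd : 0 < d) :
    (invDenom α β d).natDegree < d := by
  refine (natDegree_C_mul_le _ _).trans_lt ?_
  rcases eq_or_ne ((X - C β) ^ d - (X - C α) ^ d) 0 with h | h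
  · rw [h]; simpa
  rw [natDegree_lt_iff_degree_lt h]
  refine (degree_sub_lt_left ?_ (pow_ne_zero _ (X_sub_C_ne_zero β)) ?_).trans_le ?_
  · simp [degree_pow]
  · simp [leadingCoeff_pow]
  · simp [degree_pow]

theorem natDegree_invNum_le (α β : E) {d : ℕ} (hd : 0 < d) : (invNum α β d).natDegree ≤ d := by
  refine (natDegree_add_le _ _).trans (max_le ?_ ?_)
  · simp
  · exact (natDegree_C_mul_le _ _).trans (natDegree_invDenom_lt α β hd).le

theorem coeff_invNum (α β : E) {d : ℕ} (hd : 0 < d) : (invNum α β d).coeff d = 1 := by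
  rw [invNum, coeff_add, coeff_C_mul,
    coeff_eq_zero_of_natDegree_lt (natDegree_invDenom_lt α β hd), mul_zero, add_zero]
  have h := (monic_X_sub_C α).pow d
  have h2 := h.coeff_natDegree
  rwa [natDegree_pow, natDegree_X_sub_C, mul_one] at h2

theorem isCoprime_invNum_invDenom (hαβ : α ≠ β) (d : ℕ) :
    IsCoprime (invNum α β d) (invDenom α β d) := by
  have h : IsCoprime ((X - C α) ^ d) ((X - C β) ^ d) :=
    (isCoprime_X_sub_C_of_isUnit_sub (sub_ne_zero.mpr hαβ).isUnit).pow
  rw [← invNum_sub α β, ← invNum_sub' hαβ] at h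
  obtain ⟨u, v, h⟩ := h
  exact ⟨u + v, -u * C α - v * C β, by linear_combination h⟩

theorem mob_invDenom {d : ℕ} (hd : α ^ d = β ^ d) :
    mob α β d (invDenom α β d) = C (α ^ d) * invDenom α β d := by
  rw [invDenom, mob_C_mul, map_sub, mob_X_sub_C_pow', mob_X_sub_C_pow, ← hd]
  ring

theorem mob_invNum {d : ℕ} (hd : α ^ d = β ^ d) :
    mob α β d (invNum α β d) = C (α ^ d) * invNum α β d := by
  rw [invNum, map_add, mob_C_mul, mob_invDenom hd, mob_X_sub_C_pow, ← hd]
  ring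

/-- Composition of forms of degree `k` with the rational function of degree `d` which is invariant
under a homography of order `d` with fixed points `α` and `β`. -/
noncomputable def invSubst (α β : E) (d k : ℕ) : E[X] →ₗ[E] E[X] :=
  homSubst k (invNum α β d) (invDenom α β d)

theorem natDegree_invSubst_le {d : ℕ} (hd : 0 < d) (k : ℕ) (p : E[X]) :
    (invSubst α β d k p).natDegree ≤ d * k :=
  natDegree_homSubst_le k p (natDegree_invNum_le α β hd) (natDegree_invDenom_lt α β hd).le

theorem coeff_invSubst {d : ℕ} (hd : 0 < d) (k : ℕ) (p : E[X]) :
    (invSubst α β d k p).coeff (d * k) = p.coeff k :=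
  coeff_homSubst k p (natDegree_invNum_le α β hd) (coeff_invNum α β hd)
    (natDegree_invDenom_lt α β hd)

theorem mob_invSubst {d : ℕ} (hd0 : 0 < d) (hd : α ^ d = β ^ d) (k : ℕ) (p : E[X]) :
    mob α β (d * k) (invSubst α β d k p) = C (α ^ (d * k)) * invSubst α β d k p := by
  have h1 := natDegree_invNum_le α β hd0
  have h2 := (natDegree_invDenom_lt α β hd0).le
  have key : mob α β (d * k) (invSubst α β d k p) =
      homSubst k (mob α β d (invNum α β d)) (mob α β d (invDenom α β d)) p := by
    rw [invSubst, homSubst_eq_sum, homSubst_eq_sum, map_sum]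
    refine Finset.sum_congr rfl fun i hi ↦ ?_
    have hi' : d * k = d * i + d * (k - i) := by
      rw [← mul_add, Nat.add_sub_cancel' (Nat.lt_succ_iff.mp (Finset.mem_range.mp hi))]
    rw [← C_eq_algebraMap, mob_C_mul, hi', mob_mul]
    · rw [mob, homSubst_pow _ _ _ h1, mob, homSubst_pow _ _ _ h2]
      rfl
    · exact (natDegree_pow_le_of_le _ h1).trans (mul_comm _ _).le
    · exact (natDegree_pow_le_of_le _ h2).trans (mul_comm _ _).le
  rw [key, mob_invNum hd, mob_invDenom hd, homSubst_mul_mul, invSubst, pow_mul, ← C_pow]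

theorem exists_invSubst_of_mob_eq (hα : α ≠ 0) (hβ : β ≠ 0) (hαβ : α ≠ β) {d : ℕ} (hd0 : 0 < d)
    (hd : α ^ d = β ^ d) (hd' : ∀ i, 0 < i → i < d → α ^ i ≠ β ^ i) (k : ℕ) {p : E[X]}
    (hp : p.natDegree ≤ d * k) (h : mob α β (d * k) p = C (α ^ (d * k)) * p) :
    ∃ r : E[X], r.natDegree ≤ k ∧ p = invSubst α β d k r := by
  induction k generalizing p with
  | zero =>
    refine ⟨p, by simpa using hp, ?_⟩
    rw [Nat.mul_zero] at hp
    rw [eq_C_of_natDegree_le_zero hp, invSubst, homSubst_C, ← C_eq_algebraMap]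
    simp
  | succ k ih =>
    obtain ⟨d, rfl⟩ : ∃ e, d = e + 1 := ⟨d - 1, by omega⟩
    set m := (d + 1) * k with hm
    have hn : (d + 1) * (k + 1) = d + m + 1 := by rw [hm]; ring
    rw [hn] at hp h
    obtain ⟨e, he⟩ : ∃ e : E, (p - C e * (X - C β) ^ (d + m + 1)).eval α = 0 := by
      refine ⟨p.eval α / (α - β) ^ (d + m + 1), ?_⟩
      simp [sub_ne_zero.mpr hαβ]
    have hdeg : (p - C e * (X - C β) ^ (d + m + 1)).natDegree ≤ d + m + 1 := by
      refine (natDegree_sub_le _ _).trans (max_le hp ((natDegree_C_mul_le _ _).trans ?_))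
      simp
    obtain ⟨q, hq, hqe⟩ := exists_X_sub_C_mul hdeg he
    have hpow : α ^ (d + m + 1) = β * (β ^ d * α ^ m) := by
      rw [add_right_comm, pow_add, hd]; ring
    have h1 : mob α β (d + m) q = C (β ^ d * α ^ m) * q := by
      refine mob_eq_of_mob_X_sub_C_mul hq ?_ hβ
      rw [← hqe, map_sub, mob_C_mul, h, mob_X_sub_C_pow', ← mul_left_comm, ← mul_sub, hqe, hpow,
        C_mul]
      ring
    obtain ⟨r, hr, rfl, h2⟩ := exists_X_sub_C_pow_mul hα hβ d m
      (fun i hi hid ↦ hd' i hi (by omega)) hq h1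
    obtain ⟨r, hr', rfl⟩ := ih hr h2
    have hb : (C e * (X - C β) ^ (k + 1) : E[X]).natDegree ≤ k + 1 :=
      (natDegree_C_mul_le _ _).trans (by simp)
    have ha : ((X - C α) * r).natDegree ≤ k + 1 := by
      refine natDegree_mul_le.trans ?_
      rw [natDegree_X_sub_C]; omega
    refine ⟨C e * (X - C β) ^ (k + 1) + (X - C α) * r,
      (natDegree_add_le _ _).trans (max_le hb ha), ?_⟩
    have hlin (c : E) : homSubst 1 (invNum α β (d + 1)) (invDenom α β (d + 1)) (X - C c) =
        invNum α β (d + 1) - C c * invDenom α β (d + 1) := by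
      rw [map_sub, homSubst_one_X, homSubst_C, ← C_eq_algebraMap, pow_one]
    have hpw := homSubst_pow (k + 1) (invNum α β (d + 1)) (invDenom α β (d + 1))
      (natDegree_X_sub_C_le β)
    rw [one_mul, hlin, invNum_sub' hαβ, ← pow_mul, hn] at hpw
    rw [invSubst, map_add, homSubst_C_mul, hpw, add_comm k 1,
      homSubst_mul _ _ (natDegree_X_sub_C_le α) hr', hlin, invNum_sub, ← C_eq_algebraMap]
    rw [invSubst] at hqe
    linear_combination hqe

/-- The eigenvectors of `mob α β n`. -/
theorem exists_eq_of_mob_eq (hα : α ≠ 0) (hβ : β ≠ 0) (hαβ : α ≠ β) {d : ℕ} (hd0 : 0 < d)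
    (hd : α ^ d = β ^ d) (hd' : ∀ i, 0 < i → i < d → α ^ i ≠ β ^ i) {c c' : ℕ} (hc : c < d)
    (hc' : c' < d) (k : ℕ) {p : E[X]} (hp : p.natDegree ≤ c + (c' + d * k))
    (h : mob α β (c + (c' + d * k)) p = C (β ^ c * α ^ (c' + d * k)) * p) :
    ∃ r : E[X], r.natDegree ≤ k ∧ p = (X - C α) ^ c * ((X - C β) ^ c' * invSubst α β d k r) := by
  obtain ⟨q, hq, rfl, h1⟩ := exists_X_sub_C_pow_mul hα hβ c _
    (fun i hi hid ↦ hd' i hi (by omega)) hp h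
  rw [mob_comm, pow_add, pow_mul, hd, ← pow_mul] at h1
  obtain ⟨r, hr, rfl, h2⟩ := exists_X_sub_C_pow_mul hβ hα c' _
    (fun i hi hid ↦ (hd' i hi (by omega)).symm) hq h1
  rw [mob_comm, pow_mul, ← hd, ← pow_mul] at h2
  obtain ⟨r, hr', rfl⟩ := exists_invSubst_of_mob_eq hα hβ hαβ hd0 hd hd' k hr h2
  exact ⟨r, hr', rfl⟩

theorem mob_eq_of_eq {d : ℕ} (hd0 : 0 < d) (hd : α ^ d = β ^ d) (c c' k : ℕ) (r : E[X]) :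
    mob α β (c + (c' + d * k)) ((X - C α) ^ c * ((X - C β) ^ c' * invSubst α β d k r)) =
      C (β ^ c * α ^ (c' + d * k)) *
        ((X - C α) ^ c * ((X - C β) ^ c' * invSubst α β d k r)) := by
  have h1 (a : E) (c : ℕ) : ((X - C a) ^ c).natDegree ≤ c := by simp
  have h2 := natDegree_invSubst_le (α := α) (β := β) hd0 k r
  rw [mob_mul (h1 α c), mob_mul (h1 β c') h2, mob_X_sub_C_pow, mob_X_sub_C_pow',
    mob_invSubst hd0 hd, pow_add, C_mul, C_mul]
  · ring
  · exact natDegree_mul_le.trans (add_le_add (h1 β c') h2)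

end Mobius

/-! ### Quadratic extensions -/

/-- `φ` is the nontrivial automorphism of a quadratic extension `E / F`, `α` is an element of `E`
not in `F`, and `d` is the order of `φ α / α`. -/
structure IsConjElement {F E : Type*} [Field F] [Field E] [Algebra F E] (φ : E →ₐ[F] E) (α : E)
    (d : ℕ) : Prop where
  invol : ∀ x, φ (φ x) = x
  fixed : ∀ x, φ x = x → x ∈ Set.range (algebraMap F E)
  ne : φ α ≠ α
  pos : 0 < d
  pow_eq : α ^ d = φ α ^ d
  pow_ne : ∀ i, 0 < i → i < d → α ^ i ≠ φ α ^ i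

section Conj

variable {F E : Type*} [Field F] [Field E] [Algebra F E]

/-- The action of an automorphism on the coefficients of a polynomial. -/
noncomputable def conj (φ : E →ₐ[F] E) : E[X] →+* E[X] := mapRingHom (φ : E →+* E)

variable {φ : E →ₐ[F] E} {α : E} {d n : ℕ}

theorem conj_C (x : E) : conj φ (C x) = C (φ x) := by simp [conj]

theorem conj_X : conj φ X = X := by simp [conj]

theorem conj_map_algebraMap (p : F[X]) :
    conj φ (p.map (algebraMap F E)) = p.map (algebraMap F E) := by
  rw [conj, coe_mapRingHom, Polynomial.map_map]
  congr 1
  ext x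
  simp

theorem coeff_conj (p : E[X]) (i : ℕ) : (conj φ p).coeff i = φ (p.coeff i) := by
  simp [conj]

theorem natDegree_conj (p : E[X]) : (conj φ p).natDegree = p.natDegree := by
  simp [conj, natDegree_map]

theorem eval_conj (p : E[X]) (x : E) : (conj φ p).eval (φ x) = φ (p.eval x) := by
  rw [conj, coe_mapRingHom, ← RingHom.coe_coe φ, eval_map, eval₂_hom]

theorem conj_mob (h : ∀ x, φ (φ x) = x) (p : E[X]) :
    conj φ (mob α (φ α) n p) = mob α (φ α) n (conj φ p) := by
  rw [conj, coe_mapRingHom, mob, map_homSubst_polynomial]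
  congr 2
  · simp [h, add_comm, mul_comm]
  · simp

theorem map_homSubst_eq_mob {s t : F} (hs : algebraMap F E s = α + φ α)
    (ht : algebraMap F E t = α * φ α) (p : F[X]) :
    (homSubst n (C s * X - C t) X p).map (algebraMap F E) =
      mob α (φ α) n (p.map (algebraMap F E)) := by
  rw [map_homSubst_polynomial, mob]
  simp [hs, ht]

theorem conj_add_C_mul (a b : F[X]) :
    conj φ (a.map (algebraMap F E) + C α * b.map (algebraMap F E)) =
      a.map (algebraMap F E) + C (φ α) * b.map (algebraMap F E) := by
  rw [map_add, map_mul, conj_C, conj_map_algebraMap, conj_map_algebraMap]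

namespace IsConjElement

variable (h : IsConjElement φ α d)

include h

theorem ne_zero : α ≠ 0 := fun h0 ↦ h.ne (by rw [h0, map_zero])

theorem conj_ne_zero : φ α ≠ 0 := (map_ne_zero φ).mpr h.ne_zero

theorem pow_eq_iff (i : ℕ) : α ^ i = φ α ^ i ↔ d ∣ i := by
  constructor
  · intro hi
    rw [← Nat.mod_add_div i d, pow_add, pow_add, pow_mul, pow_mul, ← h.pow_eq] at hi
    have h1 := mul_right_cancel₀ (pow_ne_zero _ (pow_ne_zero _ h.ne_zero)) hi
    rcases Nat.eq_zero_or_pos (i % d) with h0 | h0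
    · exact Nat.dvd_of_mod_eq_zero h0
    · exact absurd h1 (h.pow_ne _ h0 (Nat.mod_lt _ h.pos))
  · rintro ⟨j, rfl⟩
    rw [pow_mul, pow_mul, h.pow_eq]

theorem conj_conj (p : E[X]) : conj φ (conj φ p) = p := by
  ext i
  rw [coeff_conj, coeff_conj, h.invol]

theorem exists_map_eq {p : E[X]} (hp : conj φ p = p) : ∃ a : F[X], a.map (algebraMap F E) = p := by
  have : p ∈ lifts (algebraMap F E) := by
    rw [lifts_iff_coeff_lifts]
    intro i
    exact h.fixed _ (by rw [← coeff_conj, hp])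
  rwa [mem_lifts] at this

theorem exists_eq_add (p : E[X]) : ∃ a b : F[X],
    p = a.map (algebraMap F E) + C α * b.map (algebraMap F E) := by
  have hne : φ α - α ≠ 0 := sub_ne_zero.mpr h.ne
  have hC : (C (φ α) - C α) * C (φ α - α)⁻¹ = 1 := by
    rw [← C_sub, ← C_mul, mul_inv_cancel₀ hne, C_1]
  have hφ : conj φ (C (φ α - α)⁻¹) = - C (φ α - α)⁻¹ := by
    rw [conj_C, map_inv₀, map_sub, h.invol, ← neg_sub, inv_neg, C_neg]
  obtain ⟨b, hb⟩ := h.exists_map_eq (p := C (φ α - α)⁻¹ * (conj φ p - p)) (by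
    rw [map_mul, hφ, map_sub, h.conj_conj]; ring)
  obtain ⟨a, ha⟩ := h.exists_map_eq
    (p := C (φ α - α)⁻¹ * (C (φ α) * p - C α * conj φ p)) (by
    rw [map_mul, hφ, map_sub, map_mul, map_mul, conj_C, conj_C, h.conj_conj, h.invol]; ring)
  refine ⟨a, b, ?_⟩
  rw [ha, hb]
  linear_combination -p * hC

theorem coeff_eq_zero_iff {a b : F[X]} {p : E[X]}
    (hp : p = a.map (algebraMap F E) + C α * b.map (algebraMap F E)) (i : ℕ) :
    p.coeff i = 0 ↔ a.coeff i = 0 ∧ b.coeff i = 0 := by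
  rw [hp, coeff_add, coeff_C_mul, coeff_map, coeff_map]
  constructor
  · intro h0
    have h1 := congrArg φ h0
    rw [map_add, map_mul, φ.commutes, φ.commutes, map_zero] at h1
    have h2 : (φ α - α) * algebraMap F E (b.coeff i) = 0 := by linear_combination h1 - h0
    rw [mul_eq_zero, sub_eq_zero, or_iff_right h.ne] at h2
    rw [h2, mul_zero, add_zero] at h0
    exact ⟨(map_eq_zero _).mp h0, (map_eq_zero _).mp h2⟩
  · rintro ⟨h0, h1⟩
    rw [h0, h1, map_zero, mul_zero, add_zero]

theorem natDegree_le_iff {a b : F[X]} {p : E[X]}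
    (hp : p = a.map (algebraMap F E) + C α * b.map (algebraMap F E)) (n : ℕ) :
    p.natDegree ≤ n ↔ a.natDegree ≤ n ∧ b.natDegree ≤ n := by
  simp only [natDegree_le_iff_coeff_eq_zero]
  simp only [h.coeff_eq_zero_iff hp]
  exact ⟨fun h ↦ ⟨fun N hN ↦ (h N hN).1, fun N hN ↦ (h N hN).2⟩, fun h N hN ↦ ⟨h.1 N hN, h.2 N hN⟩⟩

theorem isCoprime_iff {a b : F[X]} {p : E[X]}
    (hp : p = a.map (algebraMap F E) + C α * b.map (algebraMap F E)) :
    IsCoprime p (conj φ p) ↔ IsCoprime a b := by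
  rw [← isCoprime_map (algebraMap F E), hp, conj_add_C_mul]
  have hC : (C (φ α) - C α) * C (φ α - α)⁻¹ = 1 := by
    rw [← C_sub, ← C_mul, mul_inv_cancel₀ (sub_ne_zero.mpr h.ne), C_1]
  constructor
  · rintro ⟨u, v, huv⟩
    exact ⟨u + v, u * C α + v * C (φ α), by linear_combination huv⟩
  · rintro ⟨u, v, huv⟩
    refine ⟨C (φ α - α)⁻¹ * (u * C (φ α) - v), C (φ α - α)⁻¹ * (v - u * C α), ?_⟩
    linear_combination huv + (u * a.map (algebraMap F E) + v * b.map (algebraMap F E)) * hC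

theorem formCoprime_of_isCoprime {p : E[X]} (hp : p.natDegree ≤ n) (hp' : p.coeff n ≠ 0)
    (hc : IsCoprime p (conj φ p)) {a b : F[X]}
    (he : p = a.map (algebraMap F E) + C α * b.map (algebraMap F E)) : FormCoprime n n a b := by
  obtain ⟨h1, h2⟩ := (h.natDegree_le_iff he n).mp hp
  refine ⟨h1, h2, (h.isCoprime_iff he).mp hc, ?_⟩
  rw [Ne, h.coeff_eq_zero_iff he] at hp'
  tauto

end IsConjElement

/-- The `F`-linear span of the coordinates of `p` in an `F`-basis of `E`. -/
def conjSpan (φ : E →ₐ[F] E) (p : E[X]) : Submodule F F[X] where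
  carrier := {w | ∃ e, w.map (algebraMap F E) = C e * p + C (φ e) * conj φ p}
  add_mem' := by
    rintro a b ⟨e, he⟩ ⟨f, hf⟩
    refine ⟨e + f, ?_⟩
    rw [Polynomial.map_add, he, hf, map_add φ, C_add, C_add]
    ring
  zero_mem' := ⟨0, by simp⟩
  smul_mem' := by
    rintro c a ⟨e, he⟩
    refine ⟨algebraMap F E c * e, ?_⟩
    rw [smul_eq_C_mul, Polynomial.map_mul, map_C, he, map_mul φ, φ.commutes, C_mul, C_mul]
    ring

namespace IsConjElement

variable (h : IsConjElement φ α d)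

include h

theorem conjSpan_eq {p : E[X]} {a b : F[X]}
    (he : p = a.map (algebraMap F E) + C α * b.map (algebraMap F E)) :
    conjSpan φ p = Submodule.span F {a, b} := by
  have hC : (C (φ α) - C α) * C (φ α - α)⁻¹ = 1 := by
    rw [← C_sub, ← C_mul, mul_inv_cancel₀ (sub_ne_zero.mpr h.ne), C_1]
  have hφ : φ (φ α - α)⁻¹ = - (φ α - α)⁻¹ := by
    rw [map_inv₀, map_sub, h.invol, ← neg_sub, inv_neg]
  apply le_antisymm
  · rintro w ⟨e, hw⟩
    rw [he, conj_add_C_mul] at hw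
    obtain ⟨x, hx⟩ := h.fixed (e + φ e) (by rw [map_add, h.invol, add_comm])
    obtain ⟨y, hy⟩ := h.fixed (e * α + φ e * φ α)
      (by rw [map_add, map_mul, map_mul, h.invol, h.invol, add_comm])
    rw [mem_span_pair_iff]
    refine ⟨x, y, map_injective _ (algebraMap F E).injective ?_⟩
    rw [hw, Polynomial.map_add, Polynomial.map_mul, Polynomial.map_mul, map_C, map_C, hx, hy]
    simp only [C_add, C_mul]
    ring
  · rw [Submodule.span_le]
    rintro w (rfl | rfl)
    · refine ⟨(φ α - α)⁻¹ * φ α, ?_⟩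
      rw [map_mul φ, hφ, h.invol, he, conj_add_C_mul, C_mul, C_mul, C_neg]
      linear_combination -w.map (algebraMap F E) * hC
    · refine ⟨-(φ α - α)⁻¹, ?_⟩
      rw [map_neg φ, hφ, he, conj_add_C_mul, C_neg, neg_neg]
      linear_combination -w.map (algebraMap F E) * hC

theorem isPencil_conjSpan {p : E[X]} (hp : p.natDegree ≤ n) (hp' : p.coeff n ≠ 0)
    (hc : IsCoprime p (conj φ p)) : IsPencil n (conjSpan φ p) := by
  obtain ⟨a, b, he⟩ := h.exists_eq_add p
  exact ⟨a, b, h.formCoprime_of_isCoprime hp hp' hc he, h.conjSpan_eq he⟩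

theorem homSubst_mem_conjSpan {s t : F} (hs : algebraMap F E s = α + φ α)
    (ht : algebraMap F E t = α * φ α) {p : E[X]} {l : E} (hp : mob α (φ α) n p = C l * p) {w : F[X]}
    (hw : w ∈ conjSpan φ p) : homSubst n (C s * X - C t) X w ∈ conjSpan φ p := by
  obtain ⟨e, he⟩ := hw
  refine ⟨e * l, ?_⟩
  have hp' := congrArg (conj φ) hp
  rw [conj_mob h.invol, map_mul, conj_C] at hp'
  rw [map_homSubst_eq_mob hs ht, he, map_add, mob_C_mul, mob_C_mul, hp, hp', map_mul φ, C_mul,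
    C_mul]
  ring

/-- `p` lies in the `E`-span of `p'` and its conjugate when they have the same `conjSpan`. -/
theorem exists_of_conjSpan_le {p p' : E[X]} (hle : conjSpan φ p ≤ conjSpan φ p') :
    ∃ x y, p = C x * p' + C y * conj φ p' := by
  obtain ⟨a, b, he⟩ := h.exists_eq_add p
  rw [h.conjSpan_eq he] at hle
  obtain ⟨e, h1⟩ := hle (Submodule.subset_span (Set.mem_insert a {b}))
  obtain ⟨f, h2⟩ := hle (Submodule.subset_span (Set.mem_insert_of_mem a rfl))
  refine ⟨e + α * f, φ e + α * φ f, ?_⟩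
  rw [he, h1, h2]
  simp only [C_add, C_mul]
  ring

end IsConjElement

end Conj

/-! ### Stable pencils -/

section PencilBasis

variable {k : Type*} [Field k] {n : ℕ}

theorem IsPencil.formCoprime {a b : k[X]} (h : IsPencil n (Submodule.span k {a, b})) :
    FormCoprime n n a b := by
  have ha : a ∈ Submodule.span k {a, b} := Submodule.subset_span (Set.mem_insert a {b})
  have hb : b ∈ Submodule.span k {a, b} := Submodule.subset_span (Set.mem_insert_of_mem a rfl)
  refine ⟨h.natDegree_le ha, h.natDegree_le hb, ?_⟩
  obtain ⟨P, Q, ⟨-, -, ⟨u, v, huv⟩, hc⟩, heq⟩ := h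
  have hP : P ∈ Submodule.span k {a, b} := heq ▸ Submodule.subset_span (Set.mem_insert P {Q})
  have hQ : Q ∈ Submodule.span k {a, b} := heq ▸ Submodule.subset_span (Set.mem_insert_of_mem P rfl)
  obtain ⟨x, y, rfl⟩ := mem_span_pair_iff.mp hP
  obtain ⟨z, w, rfl⟩ := mem_span_pair_iff.mp hQ
  refine ⟨⟨u * C x + v * C z, u * C y + v * C w, by linear_combination huv⟩, ?_⟩
  by_contra! hcon
  simp [hcon.1, hcon.2] at hc

theorem IsPencil.eq_span_pair (hn : 1 ≤ n) {W : Submodule k k[X]} (h : IsPencil n W) {a b : k[X]}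
    (ha : a ∈ W) (hb : b ∈ W) (hli : ∀ x y, C x * a + C y * b = 0 → x = 0 ∧ y = 0) :
    W = Submodule.span k {a, b} := by
  have : FiniteDimensional k W := .of_finrank_eq_succ (h.finrank_eq hn)
  have hli' : LinearIndependent k ![a, b] := by
    rw [LinearIndependent.pair_iff]
    intro x y hxy
    exact hli x y (by simpa [smul_eq_C_mul] using hxy)
  symm
  refine Submodule.eq_of_le_of_finrank_eq ?_ ?_
  · rw [Submodule.span_le]
    rintro w (rfl | rfl)
    exacts [ha, hb]
  · have := finrank_span_eq_card hli'
    rw [Matrix.range_cons_cons_empty] at this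
    rw [this, h.finrank_eq hn, Fintype.card_fin]

end PencilBasis

section StablePencil

variable {F E : Type*} [Field F] [Field E] [Algebra F E] {φ : E →ₐ[F] E} {α : E} {d n : ℕ}
  (h : IsConjElement φ α d) {s t : F} (hs : algebraMap F E s = α + φ α)
  (ht : algebraMap F E t = α * φ α)

local notation "ι" => Polynomial.map (algebraMap F E)

theorem eval_conj_map (P : F[X]) : (ι P).eval (φ α) = φ ((ι P).eval α) := by
  rw [← eval_conj, conj_map_algebraMap]

theorem FormCoprime.eval_ne_zero {P Q : F[X]} (hPQ : FormCoprime n n P Q) :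
    (ι P).eval α ≠ 0 ∨ (ι Q).eval α ≠ 0 := by
  obtain ⟨-, -, ⟨u, v, huv⟩, -⟩ := hPQ
  by_contra! hcon
  have := congrArg (fun p ↦ (ι p).eval α) huv
  simp [hcon.1, hcon.2] at this

include h in
/-- A pencil without nonzero members vanishing at `α` is spanned by the coordinates of its unique
`E`-linear combination vanishing at `α`. -/
theorem IsConjElement.exists_eq_conjSpan (hn : 1 ≤ n) {W : Submodule F F[X]} (hW : IsPencil n W)
    (hY : ∀ w ∈ W, (ι w).eval α = 0 → w = 0) :
    ∃ p : E[X], p.natDegree ≤ n ∧ p.coeff n ≠ 0 ∧ p.eval α = 0 ∧ p.eval (φ α) ≠ 0 ∧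
      IsCoprime p (conj φ p) ∧ W = conjSpan φ p ∧ p ∈ Submodule.span E (ι '' W) := by
  obtain ⟨P, Q, hPQ, hWe⟩ := id hW
  have hP : P ∈ W := hWe ▸ Submodule.subset_span (Set.mem_insert P {Q})
  have hQ : Q ∈ W := hWe ▸ Submodule.subset_span (Set.mem_insert_of_mem P rfl)
  set a := (ι P).eval α with ha
  set b := (ι Q).eval α with hb
  have hb0 : b ≠ 0 := fun h0 ↦ hPQ.ne_zero_right hn (hY Q hQ h0)
  have hφb0 : φ b ≠ 0 := (map_ne_zero φ).mpr hb0
  have hdet : b * φ a - a * φ b ≠ 0 := by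
    intro h0
    obtain ⟨x, hx⟩ := h.fixed (a / b) (by
      rw [map_div₀]
      field_simp
      linear_combination h0)
    have h1 : P - C x * Q = 0 := by
      apply hY _ (sub_mem hP (by rw [← smul_eq_C_mul]; exact W.smul_mem x hQ))
      rw [Polynomial.map_sub, Polynomial.map_mul, map_C, eval_sub, eval_mul, eval_C, hx, ← ha, ← hb,
        div_mul_cancel₀ _ hb0, sub_self]
    have h2 := hPQ.eq_zero_of_add_eq_zero hn (x := 1) (y := -x)
      (by rw [C_1, C_neg]; linear_combination h1)
    exact one_ne_zero h2.1
  have hdetC : C (b * φ a - a * φ b) * C (b * φ a - a * φ b)⁻¹ = 1 := by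
    rw [← C_mul, mul_inv_cancel₀ hdet, C_1]
  have hcj : conj φ (C b * ι P - C a * ι Q) = C (φ b) * ι P - C (φ a) * ι Q := by
    rw [map_sub, map_mul, map_mul, conj_C, conj_C, conj_map_algebraMap, conj_map_algebraMap]
  have hdeg : (C b * ι P - C a * ι Q).natDegree ≤ n := by
    refine (natDegree_sub_le _ _).trans (max_le ?_ ?_) <;>
    refine (natDegree_C_mul_le _ _).trans (natDegree_map_le.trans ?_)
    exacts [hPQ.1, hPQ.2.1]
  have hcop : IsCoprime (C b * ι P - C a * ι Q) (conj φ (C b * ι P - C a * ι Q)) := by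
    rw [hcj]
    obtain ⟨u, v, huv⟩ := (isCoprime_map (algebraMap F E)).mpr hPQ.2.2.1
    refine ⟨C (b * φ a - a * φ b)⁻¹ * (u * C (φ a) + v * C (φ b)),
      -C (b * φ a - a * φ b)⁻¹ * (u * C a + v * C b), ?_⟩
    simp only [C_sub, C_mul] at hdetC ⊢
    linear_combination huv + (u * ι P + v * ι Q) * hdetC
  have hcoeff : (C b * ι P - C a * ι Q).coeff n ≠ 0 := by
    intro h0
    have h1 := congrArg φ h0
    rw [← coeff_conj, hcj, map_zero] at h1
    simp only [coeff_sub, coeff_C_mul, coeff_map] at h0 h1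
    have hQn : (b * φ a - a * φ b) * algebraMap F E (Q.coeff n) = 0 := by
      linear_combination φ b * h0 - b * h1
    have hPn : (b * φ a - a * φ b) * algebraMap F E (P.coeff n) = 0 := by
      linear_combination φ a * h0 - a * h1
    simp only [mul_eq_zero, hdet, false_or, map_eq_zero] at hQn hPn
    exact hPQ.2.2.2.elim (· hPn) (· hQn)
  refine ⟨C b * ι P - C a * ι Q, hdeg, hcoeff, ?_, ?_, hcop, ?_, ?_⟩
  · rw [eval_sub, eval_mul, eval_mul, eval_C, eval_C, ← ha, ← hb, mul_comm, sub_self]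
  · rwa [eval_sub, eval_mul, eval_mul, eval_C, eval_C, eval_conj_map, eval_conj_map, ← ha, ← hb]
  · refine ((h.isPencil_conjSpan hdeg hcoeff hcop).eq_of_le hn hW ?_).symm
    rintro w ⟨e, he⟩
    obtain ⟨x, hx⟩ := h.fixed (e * b + φ e * φ b)
      (by rw [map_add, map_mul, map_mul, h.invol, h.invol, add_comm])
    obtain ⟨y, hy⟩ := h.fixed (e * a + φ e * φ a)
      (by rw [map_add, map_mul, map_mul, h.invol, h.invol, add_comm])
    rw [hWe, mem_span_pair_iff]
    refine ⟨x, -y, map_injective _ (algebraMap F E).injective ?_⟩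
    rw [he, hcj, Polynomial.map_add, Polynomial.map_mul, Polynomial.map_mul, map_C, map_C, map_neg,
      hx, hy]
    simp only [C_add, C_mul, C_neg]
    ring
  · rw [← smul_eq_C_mul, ← smul_eq_C_mul]
    exact sub_mem (Submodule.smul_mem _ _ (Submodule.subset_span ⟨P, hP, rfl⟩))
      (Submodule.smul_mem _ _ (Submodule.subset_span ⟨Q, hQ, rfl⟩))

include h hs ht in
theorem IsConjElement.mob_eq_of_eval_eq_zero (hn : 1 ≤ n) {W : Submodule F F[X]}
    (hW : IsPencil n W) (hst : ∀ w ∈ W, homSubst n (C s * X - C t) X w ∈ W)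
    (hY : ∀ w ∈ W, (ι w).eval α = 0 → w = 0) :
    ∃ p : E[X], p.natDegree ≤ n ∧ p.coeff n ≠ 0 ∧ p.eval α = 0 ∧ p.eval (φ α) ≠ 0 ∧
      IsCoprime p (conj φ p) ∧ W = conjSpan φ p ∧ mob α (φ α) n p = C (φ α ^ n) * p := by
  obtain ⟨p, hp, hc, h0, h1, hcop, hWe, hmem⟩ := h.exists_eq_conjSpan hn hW hY
  refine ⟨p, hp, hc, h0, h1, hcop, hWe, ?_⟩
  have hspan : ∀ r ∈ Submodule.span E (ι '' W),
      ∃ x y, mob α (φ α) n r = C x * p + C y * conj φ p := by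
    intro r hr
    induction hr using Submodule.span_induction with
    | mem r hr =>
      obtain ⟨w, hw, rfl⟩ := hr
      have := hst w hw
      rw [hWe] at this
      obtain ⟨e, he⟩ := this
      exact ⟨e, φ e, by rw [← he, map_homSubst_eq_mob hs ht]⟩
    | zero => exact ⟨0, 0, by simp⟩
    | add r r' _ _ hr hr' =>
      obtain ⟨x, y, hr⟩ := hr
      obtain ⟨x', y', hr'⟩ := hr'
      exact ⟨x + x', y + y', by rw [map_add, hr, hr', C_add, C_add]; ring⟩
    | smul c r _ hr =>
      obtain ⟨x, y, hr⟩ := hr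
      exact ⟨c * x, c * y, by rw [map_smul, hr, smul_eq_C_mul, C_mul, C_mul]; ring⟩
  obtain ⟨x, y, hxy⟩ := hspan p hmem
  have e1 := eval_mob (β := φ α) h.ne_zero hp
  have hcα : (conj φ p).eval α = φ (p.eval (φ α)) := by rw [← eval_conj, h.invol]
  have hne : φ (p.eval (φ α)) ≠ 0 := (map_ne_zero φ).mpr h1
  have hcβ : (conj φ p).eval (φ α) = 0 := by rw [eval_conj, h0, map_zero]
  rw [hxy, eval_add, eval_mul, eval_mul, eval_C, eval_C, h0, mul_zero, zero_add, mul_zero,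
    hcα, mul_eq_zero, or_iff_left hne] at e1
  rw [mob_comm] at hxy
  have e2 := eval_mob (β := α) h.conj_ne_zero hp
  rw [hxy, eval_add, eval_mul, eval_mul, eval_C, eval_C, hcβ, mul_zero, add_zero] at e2
  rw [mob_comm, hxy, e1, mul_right_cancel₀ h1 e2, C_0, zero_mul, add_zero]

include h hs ht in
/-- A stable pencil with a nonzero member vanishing at `α`: the normal form of the action. -/
theorem IsConjElement.exists_of_eval_eq_zero (hn : 1 ≤ n) {W : Submodule F F[X]}
    (hW : IsPencil n W) (hst : ∀ w ∈ W, homSubst n (C s * X - C t) X w ∈ W)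
    (hX : ∃ w ∈ W, w ≠ 0 ∧ (ι w).eval α = 0) :
    ∃ w v l m, W = Submodule.span F {w, v} ∧ w ≠ 0 ∧ (ι v).eval α ≠ 0 ∧
      algebraMap F E m = α ^ n ∧
      homSubst n (C s * X - C t) X w = C l * w ∧ homSubst n (C s * X - C t) X v = C m * v := by
  obtain ⟨w, hw, hw0, hwα⟩ := hX
  obtain ⟨v, hv, hvα⟩ : ∃ v ∈ W, (ι v).eval α ≠ 0 := by
    obtain ⟨P, Q, hPQ, hWe⟩ := id hW
    have hP : P ∈ W := hWe ▸ Submodule.subset_span (Set.mem_insert P {Q})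
    have hQ : Q ∈ W := hWe ▸ Submodule.subset_span (Set.mem_insert_of_mem P rfl)
    exact hPQ.eval_ne_zero.elim (⟨P, hP, ·⟩) (⟨Q, hQ, ·⟩)
  have hspan (v : F[X]) (hv : v ∈ W) (hvα : (ι v).eval α ≠ 0) : W = Submodule.span F {w, v} := by
    refine hW.eq_span_pair hn hw hv fun x y hxy ↦ ?_
    have hy := congrArg (fun p ↦ (ι p).eval α) hxy
    simp only [Polynomial.map_add, Polynomial.map_mul, map_C, eval_add, eval_mul, eval_C, hwα,
      mul_zero, zero_add, Polynomial.map_zero, eval_zero, mul_eq_zero, hvα, or_false,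
      map_eq_zero] at hy
    rw [hy, C_0, zero_mul, add_zero, mul_eq_zero, or_iff_left hw0, C_eq_zero] at hxy
    exact ⟨hxy, hy⟩
  have hev (z : F[X]) (hz : z ∈ W) : (ι (homSubst n (C s * X - C t) X z)).eval α =
      α ^ n * (ι z).eval α := by
    rw [map_homSubst_eq_mob hs ht]
    exact eval_mob h.ne_zero (natDegree_map_le.trans (hW.natDegree_le hz))
  have hlc (z : F[X]) (hz : z ∈ W) :
      ∃ x y, C x * w + C y * v = z ∧ (ι z).eval α = algebraMap F E y * (ι v).eval α := by
    obtain ⟨x, y, hxy⟩ := mem_span_pair_iff.mp (hspan v hv hvα ▸ hz)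
    exact ⟨x, y, hxy, by simp [← hxy, hwα]⟩
  obtain ⟨l, y, hl, hy⟩ := hlc _ (hst w hw)
  rw [hev w hw, hwα, mul_zero, eq_comm, mul_eq_zero, or_iff_left hvα, map_eq_zero] at hy
  rw [hy, C_0, zero_mul, add_zero] at hl
  obtain ⟨ν, m, hm, hm'⟩ := hlc _ (hst v hv)
  rw [hev v hv] at hm'
  have hm' := (mul_right_cancel₀ hvα hm').symm
  by_cases hlm : l = m
  · refine ⟨w, v, l, m, hspan v hv hvα, hw0, hvα, hm', hl.symm, ?_⟩
    have hss := mob_semisimple h.ne_zero h.conj_ne_zero h.ne.symm n (l := algebraMap F E m)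
      (p := ι v) (r := C (algebraMap F E ν) * ι w)
      (natDegree_map_le.trans (hW.natDegree_le hv))
      ((natDegree_C_mul_le _ _).trans (natDegree_map_le.trans (hW.natDegree_le hw)))
      (by rw [← map_homSubst_eq_mob hs ht, ← hm]; simp [add_comm])
      (by rw [mob_C_mul, ← map_homSubst_eq_mob hs ht, ← hl, hlm]; simp [mul_left_comm])
    rw [← map_C, ← Polynomial.map_mul, Polynomial.map_eq_zero] at hss
    rw [← hm, hss, zero_add]
  · have hlm' : m - l ≠ 0 := sub_ne_zero.mpr (Ne.symm hlm)
    refine ⟨w, v + C (ν / (m - l)) * w, l, m, hspan _ ?_ ?_, hw0, ?_, hm', hl.symm, ?_⟩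
    · rw [← smul_eq_C_mul]
      exact add_mem hv (W.smul_mem _ hw)
    · simpa [hwα] using hvα
    · simpa [hwα] using hvα
    · have : C (m - l) * C (ν / (m - l)) = C ν := by rw [← C_mul, mul_div_cancel₀ _ hlm']
      rw [C_sub] at this
      rw [map_add, homSubst_C_mul, ← C_eq_algebraMap, ← hl, ← hm]
      linear_combination -w * this

theorem IsConjElement.dvd_of_algebraMap_eq (h : IsConjElement φ α d) {m : F}
    (hm : algebraMap F E m = α ^ n) : d ∣ n := by
  rw [← h.pow_eq_iff, ← map_pow, ← hm, φ.commutes]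

end StablePencil

/-! ### Stable pencils when the order does not divide the degree -/

theorem homSubst_injective {k : Type*} [Field k] {A B : k[X]} {d : ℕ} (hA : A.natDegree ≤ d)
    (hA1 : A.coeff d = 1) (hB : B.natDegree < d) (hB0 : B ≠ 0) (n : ℕ) {p q : k[X]}
    (hp : p.natDegree ≤ n) (hq : q.natDegree ≤ n) (h : homSubst n A B p = homSubst n A B q) :
    p = q := by
  by_contra hne
  have hsub : p - q ≠ 0 := sub_ne_zero.mpr hne
  have hd : (p - q).natDegree ≤ n := (natDegree_sub_le _ _).trans (max_le hp hq)
  obtain ⟨m, hm⟩ := Nat.exists_eq_add_of_le hd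
  have h0 : homSubst n A B (p - q) = 0 := by rw [map_sub, h, sub_self]
  rw [hm, homSubst_add_of_natDegree_le _ _ _ le_rfl, mul_eq_zero,
    or_iff_left (pow_ne_zero _ hB0)] at h0
  have h1 := coeff_homSubst (p - q).natDegree (p - q) hA hA1 hB
  rw [h0, coeff_zero, coeff_natDegree, eq_comm, leadingCoeff_eq_zero] at h1
  exact hsub h1

section InvSubst

variable {E : Type*} [Field E] {α β : E}

theorem eval_invDenom_left (α β : E) {d : ℕ} (hd : 0 < d) :
    (invDenom α β d).eval α = (α - β)⁻¹ * (α - β) ^ d := by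
  simp [invDenom, hd.ne']

theorem invDenom_ne_zero (hαβ : α ≠ β) {d : ℕ} (hd : 0 < d) : invDenom α β d ≠ 0 := by
  intro h
  have := eval_invDenom_left α β hd
  rw [h, eval_zero, eq_comm] at this
  simp [sub_ne_zero.mpr hαβ] at this

theorem eval_invSubst_left (hαβ : α ≠ β) {d : ℕ} (hd : 0 < d) {k : ℕ} {p : E[X]}
    (hp : p.natDegree ≤ k) :
    (invSubst α β d k p).eval α = p.eval α * ((α - β)⁻¹ * (α - β) ^ d) ^ k := by
  have hB : (invDenom α β d).eval α ≠ 0 := by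
    rw [eval_invDenom_left α β hd]; simp [sub_ne_zero.mpr hαβ]
  have hA : (invNum α β d).eval α = α * (invDenom α β d).eval α := by
    have := congrArg (eval α) (invNum_sub α β d)
    simp only [eval_sub, eval_mul, eval_C, eval_pow, eval_X, sub_self, zero_pow hd.ne'] at this
    exact sub_eq_zero.mp this
  have h := map_homSubst (aeval α) k (invNum α β d) (invDenom α β d) p
  simp only [coe_aeval_eq_eval] at h
  rw [homSubst_eq_eval_div hp _ hB, hA, mul_div_cancel_right₀ _ hB, coe_aeval_eq_eval,
    eval_invDenom_left α β hd] at h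
  exact h

theorem invDenom_comm (α β : E) (d : ℕ) : invDenom α β d = invDenom β α d := by
  rw [invDenom, invDenom, ← neg_sub β α, inv_neg, C_neg]
  ring

theorem invNum_comm (hαβ : α ≠ β) (d : ℕ) : invNum α β d = invNum β α d := by
  rw [← sub_left_inj (a := C β * invDenom α β d), invNum_sub' hαβ, invDenom_comm, invNum_sub]

theorem invSubst_comm (hαβ : α ≠ β) (d k : ℕ) : invSubst α β d k = invSubst β α d k := by
  rw [invSubst, invNum_comm hαβ, invDenom_comm, invSubst]

theorem invSubst_injective (hαβ : α ≠ β) {d : ℕ} (hd : 0 < d) {k : ℕ} {p q : E[X]}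
    (hp : p.natDegree ≤ k) (hq : q.natDegree ≤ k)
    (h : invSubst α β d k p = invSubst α β d k q) : p = q :=
  homSubst_injective (natDegree_invNum_le α β hd) (coeff_invNum α β hd)
    (natDegree_invDenom_lt α β hd) (invDenom_ne_zero hαβ hd) k hp hq h

end InvSubst

section StablePencil

variable {F E : Type*} [Field F] [Field E] [Algebra F E] {φ : E →ₐ[F] E} {α : E} {d n : ℕ}
  (h : IsConjElement φ α d) {s t : F} (hs : algebraMap F E s = α + φ α)
  (ht : algebraMap F E t = α * φ α)

theorem conjSpan_C_mul_le (c : E) (p : E[X]) : conjSpan φ (C c * p) ≤ conjSpan φ p := by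
  rintro w ⟨e, he⟩
  refine ⟨e * c, ?_⟩
  rw [he, map_mul, conj_C, map_mul φ, C_mul, C_mul]
  ring

theorem conjSpan_C_mul {c : E} (hc : c ≠ 0) (p : E[X]) :
    conjSpan φ (C c * p) = conjSpan φ p := by
  refine le_antisymm (conjSpan_C_mul_le c p) ?_
  have := conjSpan_C_mul_le (φ := φ) c⁻¹ (C c * p)
  rwa [← mul_assoc, ← C_mul, inv_mul_cancel₀ hc, C_1, one_mul] at this

namespace IsConjElement

include h

theorem conj_invDenom : conj φ (invDenom α (φ α) d) = invDenom α (φ α) d := by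
  have key : conj φ (invDenom α (φ α) d) = invDenom (φ α) α d := by
    rw [invDenom, invDenom, map_mul, map_sub, map_pow, map_pow, map_sub, map_sub, conj_C, conj_C,
      conj_C, conj_X, map_inv₀, map_sub, h.invol]
  rw [key, invDenom_comm]

theorem conj_invNum : conj φ (invNum α (φ α) d) = invNum α (φ α) d := by
  nth_rw 1 [invNum]
  rw [map_add, map_mul, h.conj_invDenom, map_pow, map_sub, conj_C, conj_X, ← invNum_sub' h.ne.symm,
    sub_add_cancel]

theorem conj_invSubst (k : ℕ) (p : E[X]) :
    conj φ (invSubst α (φ α) d k p) = invSubst α (φ α) d k (conj φ p) := by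
  have hN := h.conj_invNum
  have hD := h.conj_invDenom
  simp only [conj, coe_mapRingHom] at hN hD
  rw [invSubst, conj, coe_mapRingHom, map_homSubst_polynomial, hN, hD]

theorem conj_X_sub_C_pow_mul (r k : ℕ) (p : E[X]) :
    conj φ ((X - C α) ^ r * invSubst α (φ α) d k p) =
      (X - C (φ α)) ^ r * invSubst α (φ α) d k (conj φ p) := by
  rw [map_mul, map_pow, map_sub, conj_X, conj_C, h.conj_invSubst]

theorem eval_invSubst {k : ℕ} {p : E[X]} (hp : p.natDegree ≤ k) :
    (invSubst α (φ α) d k p).eval α = 0 ↔ p.eval α = 0 := by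
  rw [eval_invSubst_left h.ne.symm h.pos hp, mul_eq_zero, or_iff_left]
  simp [sub_ne_zero.mpr h.ne.symm]

theorem eval_invSubst' {k : ℕ} {p : E[X]} (hp : p.natDegree ≤ k) :
    (invSubst α (φ α) d k p).eval (φ α) = 0 ↔ p.eval (φ α) = 0 := by
  rw [invSubst_comm h.ne.symm, eval_invSubst_left h.ne h.pos hp, mul_eq_zero, or_iff_left]
  simp [sub_ne_zero.mpr h.ne]

end IsConjElement

theorem coeff_X_sub_C_pow_mul (a : E) (r : ℕ) {m : ℕ} {p : E[X]} (hp : p.natDegree ≤ m) :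
    ((X - C a) ^ r * p).coeff (r + m) = p.coeff m := by
  rw [coeff_mul_add_eq_of_natDegree_le (by simp) hp]
  have h2 := ((monic_X_sub_C a).pow r).coeff_natDegree
  rw [natDegree_pow, natDegree_X_sub_C, mul_one] at h2
  rw [h2, one_mul]

theorem isCoprime_X_sub_C {a : E} {p : E[X]} (hp : p.eval a ≠ 0) : IsCoprime (X - C a) p :=
  (irreducible_X_sub_C a).coprime_iff_not_dvd.mpr (by rwa [dvd_iff_isRoot])

include h in
theorem IsConjElement.isCoprime_X_sub_C_pow_mul {k : ℕ} {p : E[X]} (hp : p.natDegree ≤ k)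
    (hpk : p.coeff k ≠ 0) (hc : IsCoprime p (conj φ p)) (hpα : p.eval (φ α) ≠ 0) (r : ℕ) :
    IsCoprime ((X - C α) ^ r * invSubst α (φ α) d k p)
      (conj φ ((X - C α) ^ r * invSubst α (φ α) d k p)) := by
  have hp' : (conj φ p).natDegree ≤ k := (natDegree_conj p).trans_le hp
  rw [h.conj_X_sub_C_pow_mul]
  have h1 : (conj φ p).eval α ≠ 0 := by
    rw [← h.invol α, eval_conj]
    exact (map_ne_zero φ).mpr hpα
  refine IsCoprime.mul_left (IsCoprime.mul_right ?_ ?_) (IsCoprime.mul_right ?_ ?_)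
  · exact (isCoprime_X_sub_C_of_isUnit_sub (sub_ne_zero.mpr h.ne.symm).isUnit).pow
  · exact (isCoprime_X_sub_C (by rwa [Ne, h.eval_invSubst hp'])).pow_left
  · exact (isCoprime_X_sub_C (by rwa [Ne, h.eval_invSubst' hp])).symm.pow_right
  · exact FormCoprime.isCoprime_homSubst ⟨hp, hp', hc, .inl hpk⟩
      (isCoprime_invNum_invDenom h.ne.symm d)

include h hs ht in
theorem card_stable_pencil_of_not_dvd {r k : ℕ} (hr0 : 0 < r) (hrd : r < d) (hn : n = r + d * k) :
    Nat.card {W : Submodule F F[X] //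
        IsPencil n W ∧ ∀ w ∈ W, homSubst n (C s * X - C t) X w ∈ W} =
      Nat.card {p : E[X] // p.Monic ∧ p.natDegree = k ∧ IsCoprime p (conj φ p) ∧
        p.eval (φ α) ≠ 0} := by
  have hn1 : 1 ≤ n := by omega
  have hdn : ¬ d ∣ n := by
    rw [hn, Nat.dvd_add_left (dvd_mul_right d k)]
    exact Nat.not_dvd_of_pos_of_lt hr0 hrd
  symm
  let Z (p : E[X]) : E[X] := (X - C α) ^ r * invSubst α (φ α) d k p
  have hZdeg (p : E[X]) : (Z p).natDegree ≤ n := by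
    rw [hn]
    exact natDegree_mul_le.trans (add_le_add (by simp) (natDegree_invSubst_le h.pos k p))
  have hZcoeff (p : E[X]) : (Z p).coeff n = p.coeff k := by
    rw [hn, coeff_X_sub_C_pow_mul _ _ (natDegree_invSubst_le h.pos k p), coeff_invSubst h.pos]
  have hZmob (p : E[X]) : mob α (φ α) n (Z p) = C (φ α ^ r * α ^ (d * k)) * Z p := by
    have := mob_eq_of_eq h.pos h.pow_eq r 0 k p
    rwa [pow_zero, one_mul, zero_add, ← hn] at this
  have hZα (p : E[X]) : (Z p).eval α = 0 := by simp [Z, hr0.ne']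
  have hZα' (p : E[X]) (hp : p.natDegree ≤ k) : (Z p).eval (φ α) = 0 ↔ p.eval (φ α) = 0 := by
    simp only [Z, eval_mul, eval_pow, eval_sub, eval_X, eval_C, mul_eq_zero, h.eval_invSubst' hp,
      pow_eq_zero_iff hr0.ne', sub_ne_zero.mpr h.ne, false_or]
  refine Nat.card_congr (Equiv.ofBijective (fun p ↦ ⟨conjSpan φ (Z p.1), ?_, ?_⟩) ⟨?_, ?_⟩)
  · obtain ⟨p, hp1, hp2, hp3, hp4⟩ := p
    have hpk : p.coeff k = 1 := by rw [← hp2]; exact hp1.coeff_natDegree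
    exact h.isPencil_conjSpan (hZdeg p) (by rw [hZcoeff, hpk]; exact one_ne_zero)
      (h.isCoprime_X_sub_C_pow_mul hp2.le (by rw [hpk]; exact one_ne_zero) hp3 hp4 r)
  · exact fun w hw ↦ h.homSubst_mem_conjSpan hs ht (hZmob _) hw
  · rintro ⟨p, hp1, hp2, hp3, hp4⟩ ⟨p', hp1', hp2', hp3', hp4'⟩ heq
    rw [Subtype.mk.injEq] at heq ⊢
    obtain ⟨x, y, hxy⟩ := h.exists_of_conjSpan_le heq.le
    have hy := congrArg (eval α) hxy
    have hne : (conj φ (Z p')).eval α ≠ 0 := by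
      rw [← h.invol α, eval_conj]
      exact (map_ne_zero φ).mpr (by rwa [Ne, hZα' _ hp2'.le])
    simp only [eval_add, eval_C_mul, hZα, mul_zero, zero_add] at hy
    rw [eq_comm, mul_eq_zero, or_iff_left hne] at hy
    rw [hy, C_0, zero_mul, add_zero] at hxy
    have hx := congrArg (coeff · n) hxy
    simp only [coeff_C_mul, hZcoeff] at hx
    have hc : p.coeff k = 1 := by rw [← hp2]; exact hp1.coeff_natDegree
    have hc' : p'.coeff k = 1 := by rw [← hp2']; exact hp1'.coeff_natDegree
    rw [hc, hc', mul_one] at hx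
    rw [← hx, C_1, one_mul] at hxy
    exact invSubst_injective h.ne.symm h.pos hp2.le hp2'.le
      (mul_left_cancel₀ (pow_ne_zero r (X_sub_C_ne_zero α)) hxy)
  · rintro ⟨W, hW, hst⟩
    have hY : ∀ w ∈ W, (w.map (algebraMap F E)).eval α = 0 → w = 0 := by
      intro w hw hwα
      by_contra hw0
      obtain ⟨_, _, _, m, -, -, -, hm, -⟩ :=
        h.exists_of_eval_eq_zero hs ht hn1 hW hst ⟨w, hw, hw0, hwα⟩
      exact hdn (h.dvd_of_algebraMap_eq hm)
    obtain ⟨q, hq, hqn, -, hq1, hqc, rfl, hqm⟩ := h.mob_eq_of_eval_eq_zero hs ht hn1 hW hst hY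
    obtain ⟨p, hp, hpq⟩ := exists_eq_of_mob_eq h.ne_zero h.conj_ne_zero h.ne.symm h.pos h.pow_eq
      h.pow_ne hrd h.pos k (p := q) (by rwa [zero_add, ← hn])
      (by rw [zero_add, ← hn, hqm, hn, pow_add, pow_mul, pow_mul, ← h.pow_eq])
    rw [pow_zero, one_mul] at hpq
    obtain rfl : q = Z p := hpq
    rw [hZcoeff] at hqn
    have hdeg : p.natDegree = k := natDegree_eq_of_le_of_coeff_ne_zero hp hqn
    have hcop : IsCoprime p (conj φ p) := by
      refine isCoprime_of_isCoprime_homSubst hp ((natDegree_conj p).trans_le hp)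
        (natDegree_invNum_le α (φ α) h.pos) (coeff_invNum α (φ α) h.pos)
        (natDegree_invDenom_lt α (φ α) h.pos) (.inl fun h0 ↦ hqn (by rw [h0, coeff_zero])) ?_
      rw [h.conj_X_sub_C_pow_mul] at hqc
      exact hqc.of_mul_left_right.of_mul_right_right
    have hu : IsUnit (C (p.coeff k)⁻¹) := isUnit_C.mpr (inv_ne_zero hqn).isUnit
    have hu' : IsUnit (C (φ (p.coeff k)⁻¹)) :=
      isUnit_C.mpr ((map_ne_zero φ).mpr (inv_ne_zero hqn)).isUnit
    refine ⟨⟨C (p.coeff k)⁻¹ * p, ?_, ?_, ?_, ?_⟩, ?_⟩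
    · rw [Monic, leadingCoeff_mul, leadingCoeff_C, leadingCoeff, hdeg, inv_mul_cancel₀ hqn]
    · rw [natDegree_C_mul (inv_ne_zero hqn), hdeg]
    · rw [map_mul, conj_C]
      exact (isCoprime_mul_unit_left_left hu _ _).mpr
        ((isCoprime_mul_unit_left_right hu' _ _).mpr hcop)
    · rw [eval_mul, eval_C]
      exact mul_ne_zero (inv_ne_zero hqn) (by rwa [Ne, ← hZα' p hp])
    · rw [Subtype.mk.injEq]
      have : Z (C (p.coeff k)⁻¹ * p) = C (p.coeff k)⁻¹ * Z p := by
        simp only [Z, ← smul_eq_C_mul, map_smul, mul_smul_comm]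
      rw [this, conjSpan_C_mul (inv_ne_zero hqn)]

end StablePencil

/-! ### Stable pencils when the order divides the degree -/

theorem exists_pow_of_mob_eq {E : Type*} [Field E] {α β : E} (hα : α ≠ 0) (hβ : β ≠ 0) {n : ℕ}
    {p : E[X]} {l : E} (hp : p.natDegree ≤ n) (hp0 : p ≠ 0) (h : mob α β n p = C l * p) :
    ∃ i j, i + j = n ∧ l = β ^ i * α ^ j := by
  have key (hpα : p.eval α ≠ 0) : ∃ i j, i + j = n ∧ l = β ^ i * α ^ j := by
    have h1 := eval_mob (β := β) hα hp
    rw [h, eval_mul, eval_C] at h1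
    exact ⟨0, n, zero_add n, by rw [mul_right_cancel₀ hpα h1, pow_zero, one_mul]⟩
  induction n generalizing p l with
  | zero =>
    apply key
    rw [eq_C_of_natDegree_le_zero hp, eval_C]
    intro h0
    rw [eq_C_of_natDegree_le_zero hp, h0, C_0] at hp0
    exact hp0 rfl
  | succ n ih =>
    by_cases hpα : p.eval α = 0
    · obtain ⟨q, hq, rfl⟩ := exists_X_sub_C_mul hp hpα
      have hC : C β * C (l / β) = C l := by rw [← C_mul, mul_div_cancel₀ _ hβ]
      have h1 := mob_eq_of_mob_X_sub_C_mul (r := C (l / β) * q) hq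
        (by rw [h]; linear_combination -(X - C α) * q * hC) hβ
      obtain ⟨i, j, hij, hl⟩ := ih hq (right_ne_zero_of_mul hp0) h1 (fun hqα ↦ by
        have h2 := eval_mob (β := β) hα hq
        rw [h1, eval_mul, eval_C] at h2
        exact ⟨0, n, zero_add n, by rw [mul_right_cancel₀ hqα h2, pow_zero, one_mul]⟩)
      refine ⟨i + 1, j, by omega, ?_⟩
      rw [div_eq_iff hβ] at hl
      rw [hl]
      ring
    · exact key hpα

theorem span_pair_C_mul {k : Type*} [Field k] {x y : k} (hx : x ≠ 0) (hy : y ≠ 0) (a b : k[X]) :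
    Submodule.span k {C x * a, C y * b} = Submodule.span k {a, b} := by
  rw [Submodule.span_insert, Submodule.span_insert, ← smul_eq_C_mul, ← smul_eq_C_mul,
    Submodule.span_singleton_smul_eq hx.isUnit, Submodule.span_singleton_smul_eq hy.isUnit]

section StablePencil

variable {F E : Type*} [Field F] [Field E] [Algebra F E] {φ : E →ₐ[F] E} {α : E} {d n : ℕ}
  (h : IsConjElement φ α d) {s t : F} (hs : algebraMap F E s = α + φ α)
  (ht : algebraMap F E t = α * φ α)

local notation "ι" => Polynomial.map (algebraMap F E)

include h hs ht in
theorem IsConjElement.exists_of_not_scalar (hn : 1 ≤ n) {m : F} (hm : algebraMap F E m = α ^ n)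
    {W : Submodule F F[X]} (hW : IsPencil n W)
    (hst : ∀ w ∈ W, homSubst n (C s * X - C t) X w ∈ W)
    (hns : ¬ ∀ w ∈ W, homSubst n (C s * X - C t) X w = C m * w) :
    Even d ∧ ∃ w v, W = Submodule.span F {w, v} ∧ w ≠ 0 ∧ (ι v).eval α ≠ 0 ∧
      homSubst n (C s * X - C t) X w = C (-m) * w ∧ homSubst n (C s * X - C t) X v = C m * v := by
  have hdn := h.dvd_of_algebraMap_eq hm
  by_cases hX : ∃ w ∈ W, w ≠ 0 ∧ (ι w).eval α = 0
  · obtain ⟨w, v, l, m', rfl, hw, hv, hm', hl, hmv⟩ := h.exists_of_eval_eq_zero hs ht hn hW hst hX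
    obtain rfl : m' = m := (algebraMap F E).injective (hm'.trans hm.symm)
    have hwW : w ∈ Submodule.span F {w, v} := Submodule.subset_span (Set.mem_insert w {v})
    have hl' : mob α (φ α) n (ι w) = C (algebraMap F E l) * ι w := by
      rw [← map_homSubst_eq_mob hs ht, hl, Polynomial.map_mul, map_C]
    obtain ⟨i, j, hij, hlij⟩ := exists_pow_of_mob_eq h.ne_zero h.conj_ne_zero
      (natDegree_map_le.trans (hW.natDegree_le hwW))
      (Polynomial.map_ne_zero hw) hl'
    have hpow : φ α ^ i * φ α ^ j = α ^ i * α ^ j := by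
      rw [← pow_add, ← pow_add, hij, (h.pow_eq_iff n).mpr hdn]
    have hsq : α ^ (2 * i) = φ α ^ (2 * i) := by
      have h1 := congrArg φ hlij
      rw [φ.commutes, map_mul, map_pow, map_pow, h.invol] at h1
      have h2 : φ α ^ j * (α ^ (2 * i) - φ α ^ (2 * i)) = 0 := by
        linear_combination α ^ i * h1.symm + α ^ i * hlij - φ α ^ i * hpow
      rw [mul_eq_zero, or_iff_right (pow_ne_zero _ h.conj_ne_zero)] at h2
      exact sub_eq_zero.mp h2
    have hlm : algebraMap F E l ≠ algebraMap F E m' := by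
      intro hlm
      apply hns
      intro z hz
      obtain ⟨x, y, rfl⟩ := mem_span_pair_iff.mp hz
      rw [map_add, homSubst_C_mul, homSubst_C_mul, hl, hmv, (algebraMap F E).injective hlm,
        ← C_eq_algebraMap, ← C_eq_algebraMap]
      ring
    have hij' : α ^ i ≠ φ α ^ i := fun h0 ↦ hlm (by rw [hlij, ← h0, hm, ← hij, pow_add])
    have heven : Even d := by
      by_contra hodd
      rw [Nat.not_even_iff_odd] at hodd
      exact hij' ((h.pow_eq_iff i).mpr
        ((Nat.Coprime.dvd_of_dvd_mul_left hodd.coprime_two_right) ((h.pow_eq_iff _).mp hsq)))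
    have hneg : φ α ^ i = - α ^ i := by
      have : (α ^ i - φ α ^ i) * (φ α ^ i + α ^ i) = 0 := by linear_combination hsq
      rw [mul_eq_zero, or_iff_right (sub_ne_zero.mpr hij')] at this
      exact eq_neg_of_add_eq_zero_left this
    have hl2 : l = -m' := (algebraMap F E).injective (by
      rw [hlij, hneg, map_neg, hm, ← hij, pow_add, neg_mul])
    exact ⟨heven, w, v, rfl, hw, hv, by rw [hl, hl2], hmv⟩
  · push Not at hX
    obtain ⟨p, -, -, -, -, -, rfl, hp⟩ := h.mob_eq_of_eval_eq_zero hs ht hn hW hst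
      (fun w hw hwα ↦ by_contra fun hw0 ↦ hX w hw hw0 hwα)
    refine absurd ?_ hns
    rintro w ⟨e, he⟩
    rw [← (h.pow_eq_iff n).mpr hdn, ← hm] at hp
    have hp' := congrArg (conj φ) hp
    rw [conj_mob h.invol, map_mul, conj_C, φ.commutes] at hp'
    apply map_injective _ (algebraMap F E).injective
    rw [map_homSubst_eq_mob hs ht, he, map_add, mob_C_mul, mob_C_mul, hp, hp', Polynomial.map_mul,
      map_C, he]
    ring

/-- `A / B` is the rational function over `F` of degree `d` invariant under the homography. -/
structure IsInvPair (α : E) (β : E) (d : ℕ) (A B : F[X]) : Prop where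
  map_num : ι A = invNum α β d
  map_denom : ι B = invDenom α β d

include h in
theorem IsConjElement.exists_isInvPair : ∃ A B : F[X], IsInvPair α (φ α) d A B := by
  obtain ⟨A, hA⟩ := h.exists_map_eq h.conj_invNum
  obtain ⟨B, hB⟩ := h.exists_map_eq h.conj_invDenom
  exact ⟨A, B, hA, hB⟩

variable {A B : F[X]} (hAB : IsInvPair α (φ α) d A B)

namespace IsInvPair

include hAB

theorem map_homSubst (k : ℕ) (p : F[X]) :
    ι (homSubst k A B p) = invSubst α (φ α) d k (ι p) := by
  rw [map_homSubst_polynomial, hAB.map_num, hAB.map_denom, invSubst]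

include h

theorem natDegree_num_le : A.natDegree ≤ d := by
  rw [← natDegree_map (algebraMap F E), hAB.map_num]
  exact natDegree_invNum_le _ _ h.pos

theorem coeff_num : A.coeff d = 1 := by
  apply (algebraMap F E).injective
  rw [← coeff_map, hAB.map_num, coeff_invNum _ _ h.pos, map_one]

theorem natDegree_denom_lt : B.natDegree < d := by
  rw [← natDegree_map (algebraMap F E), hAB.map_denom]
  exact natDegree_invDenom_lt _ _ h.pos

theorem denom_ne_zero : B ≠ 0 := by
  intro h0
  have h1 := hAB.map_denom
  rw [h0, Polynomial.map_zero] at h1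
  exact invDenom_ne_zero h.ne.symm h.pos h1.symm

theorem isCoprime : IsCoprime A B := by
  rw [← isCoprime_map (algebraMap F E), hAB.map_num, hAB.map_denom]
  exact isCoprime_invNum_invDenom h.ne.symm d

theorem injective {k : ℕ} {p q : F[X]} (hp : p.natDegree ≤ k) (hq : q.natDegree ≤ k)
    (heq : homSubst k A B p = homSubst k A B q) : p = q :=
  homSubst_injective (hAB.natDegree_num_le h) (hAB.coeff_num h) (hAB.natDegree_denom_lt h)
    (hAB.denom_ne_zero h) k hp hq heq

theorem natDegree_le (k : ℕ) (p : F[X]) : (homSubst k A B p).natDegree ≤ d * k :=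
  natDegree_homSubst_le k p (hAB.natDegree_num_le h) (hAB.natDegree_denom_lt h).le

theorem coeff (k : ℕ) (p : F[X]) : (homSubst k A B p).coeff (d * k) = p.coeff k :=
  coeff_homSubst k p (hAB.natDegree_num_le h) (hAB.coeff_num h) (hAB.natDegree_denom_lt h)

theorem isCoprime_of_isCoprime {i j : ℕ} {p q : F[X]} (hp : p.natDegree ≤ i) (hq : q.natDegree ≤ j)
    (hp0 : p ≠ 0) (hc : IsCoprime (homSubst i A B p) (homSubst j A B q)) : IsCoprime p q :=
  isCoprime_of_isCoprime_homSubst hp hq (hAB.natDegree_num_le h) (hAB.coeff_num h)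
    (hAB.natDegree_denom_lt h) (.inl hp0) hc

theorem exists_of_map_eq {k : ℕ} {p : F[X]} {r : E[X]} (hr : r.natDegree ≤ k)
    (he : ι p = invSubst α (φ α) d k r) : ∃ a : F[X], a.natDegree ≤ k ∧ r = ι a ∧
      p = homSubst k A B a := by
  have hc : conj φ r = r := by
    apply invSubst_injective h.ne.symm h.pos ((natDegree_conj r).trans_le hr) hr
    rw [← h.conj_invSubst, ← he, conj_map_algebraMap]
  obtain ⟨a, rfl⟩ := h.exists_map_eq hc
  rw [natDegree_map] at hr
  refine ⟨a, hr, rfl, map_injective _ (algebraMap F E).injective ?_⟩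
  rw [he, hAB.map_homSubst]

include hs ht

theorem homSubst_homSubst {k : ℕ} {m : F} (hm : algebraMap F E m = α ^ (d * k)) (p : F[X]) :
    homSubst (d * k) (C s * X - C t) X (homSubst k A B p) = C m * homSubst k A B p := by
  apply map_injective _ (algebraMap F E).injective
  rw [map_homSubst_eq_mob hs ht, hAB.map_homSubst, mob_invSubst h.pos h.pow_eq, Polynomial.map_mul,
    map_C, hm, hAB.map_homSubst]

theorem exists_of_homSubst_eq {k : ℕ} {m : F} (hm : algebraMap F E m = α ^ (d * k)) {p : F[X]}
    (hp : p.natDegree ≤ d * k) (hT : homSubst (d * k) (C s * X - C t) X p = C m * p) :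
    ∃ a : F[X], a.natDegree ≤ k ∧ p = homSubst k A B a := by
  obtain ⟨r, hr, he⟩ := exists_invSubst_of_mob_eq h.ne_zero h.conj_ne_zero h.ne.symm h.pos h.pow_eq
    h.pow_ne k (p := ι p) (natDegree_map_le.trans hp)
    (by rw [← map_homSubst_eq_mob hs ht, hT, Polynomial.map_mul, map_C, hm])
  obtain ⟨a, ha, -, hpa⟩ := hAB.exists_of_map_eq h hr he
  exact ⟨a, ha, hpa⟩

end IsInvPair

include h hs ht in
/-- The pencils of degree `d * k` on which the action is scalar are the pencils of degree `k`. -/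
theorem card_scalar_pencil {k : ℕ} {m : F} (hm : algebraMap F E m = α ^ (d * k)) :
    Nat.card {W : Submodule F F[X] //
        IsPencil (d * k) W ∧ ∀ w ∈ W, homSubst (d * k) (C s * X - C t) X w = C m * w} =
      Nat.card {W : Submodule F F[X] // IsPencil k W} := by
  obtain ⟨A, B, hAB⟩ := h.exists_isInvPair
  symm
  have hspan (a b : F[X]) : (Submodule.span F {a, b}).map (homSubst k A B) =
      Submodule.span F {homSubst k A B a, homSubst k A B b} := by
    rw [Submodule.map_span, Set.image_pair]
  refine Nat.card_congr (Equiv.ofBijective (fun W ↦ ⟨W.1.map (homSubst k A B), ?_, ?_⟩) ⟨?_, ?_⟩)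
  · obtain ⟨_, a, b, hab, rfl⟩ := W
    refine ⟨_, _, ⟨hAB.natDegree_le h k a, hAB.natDegree_le h k b,
      hab.isCoprime_homSubst (hAB.isCoprime h), ?_⟩, hspan a b⟩
    rw [hAB.coeff h, hAB.coeff h]
    exact hab.2.2.2
  · rintro _ ⟨w, -, rfl⟩
    exact hAB.homSubst_homSubst h hs ht hm w
  · have key {W W' : Submodule F F[X]} (hW : IsPencil k W) (hW' : IsPencil k W')
        (hle : W.map (homSubst k A B) ≤ W'.map (homSubst k A B)) : W ≤ W' := by
      intro w hw
      obtain ⟨w', hw', he⟩ := hle ⟨w, hw, rfl⟩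
      rwa [← hAB.injective h (hW'.natDegree_le hw') (hW.natDegree_le hw) he]
    rintro ⟨W, hW⟩ ⟨W', hW'⟩ heq
    rw [Subtype.mk.injEq] at heq ⊢
    exact le_antisymm (key hW hW' heq.le) (key hW' hW heq.ge)
  · rintro ⟨W, hW, hT⟩
    obtain ⟨P, Q, hPQ, rfl⟩ := id hW
    obtain ⟨a, ha, rfl⟩ := hAB.exists_of_homSubst_eq h hs ht hm hPQ.1
      (hT _ (Submodule.subset_span (Set.mem_insert P {Q})))
    obtain ⟨b, hb, rfl⟩ := hAB.exists_of_homSubst_eq h hs ht hm hPQ.2.1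
      (hT _ (Submodule.subset_span (Set.mem_insert_of_mem _ rfl)))
    have hc := hPQ.2.2.2
    rw [hAB.coeff h, hAB.coeff h] at hc
    refine ⟨⟨Submodule.span F {a, b}, a, b, ⟨ha, hb, ?_, hc⟩, rfl⟩, Subtype.ext (hspan a b)⟩
    rcases eq_or_ne a 0 with rfl | ha0
    · have hb0 : b ≠ 0 := by rintro rfl; simp at hc
      exact (hAB.isCoprime_of_isCoprime h hb ha hb0 hPQ.2.2.1.symm).symm
    · exact hAB.isCoprime_of_isCoprime h ha hb ha0 hPQ.2.2.1

end StablePencil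

section NonScalarPencil

variable {F E : Type*} [Field F] [Field E] [Algebra F E] {φ : E →ₐ[F] E} {α : E} {d n : ℕ}
  (h : IsConjElement φ α d) {s t : F} (hs : algebraMap F E s = α + φ α)
  (ht : algebraMap F E t = α * φ α)

local notation "ι" => Polynomial.map (algebraMap F E)

theorem natDegree_X_sq_sub_add (s t : F) : (X ^ 2 - C s * X + C t).natDegree = 2 := by
  compute_degree!

theorem monic_X_sq_sub_add (s t : F) : (X ^ 2 - C s * X + C t).Monic := by
  monicity!

include hs ht in
theorem map_X_sq_sub_add : ι (X ^ 2 - C s * X + C t) = (X - C α) * (X - C (φ α)) := by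
  simp only [Polynomial.map_add, Polynomial.map_sub, Polynomial.map_mul, Polynomial.map_pow, map_X,
    map_C, hs, ht, C_add, C_mul]
  ring

include hs ht in
theorem isCoprime_X_sq_sub_add {p : F[X]} (hp : (ι p).eval α ≠ 0) :
    IsCoprime (X ^ 2 - C s * X + C t) p := by
  rw [← isCoprime_map (algebraMap F E), map_X_sq_sub_add hs ht]
  refine (isCoprime_X_sub_C hp).mul_left (isCoprime_X_sub_C ?_)
  rw [eval_conj_map]
  exact (map_ne_zero φ).mpr hp

theorem FormCoprime.C_mul {k : Type*} [Field k] {i j : ℕ} {a b : k[X]} (hab : FormCoprime i j a b)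
    {x y : k} (hx : x ≠ 0) (hy : y ≠ 0) : FormCoprime i j (C x * a) (C y * b) := by
  refine ⟨(natDegree_C_mul_le _ _).trans hab.1, (natDegree_C_mul_le _ _).trans hab.2.1, ?_, ?_⟩
  · rw [isCoprime_mul_unit_left_left (isUnit_C.mpr hx.isUnit),
      isCoprime_mul_unit_left_right (isUnit_C.mpr hy.isUnit)]
    exact hab.2.2.1
  · simpa [hx, hy] using hab.2.2.2

theorem monic_C_inv_mul {k : Type*} [Field k] {p : k[X]} (hp : p ≠ 0) :
    (C p.leadingCoeff⁻¹ * p).Monic := by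
  rw [Monic, leadingCoeff_mul, leadingCoeff_C, inv_mul_cancel₀ (leadingCoeff_ne_zero.mpr hp)]

theorem eq_one_of_monic {k : Type*} [Field k] {p q : k[X]} {x : k} (hp : p.Monic) (hq : q.Monic)
    (heq : p = C x * q) : x = 1 := by
  have := congrArg leadingCoeff heq
  rwa [leadingCoeff_mul, leadingCoeff_C, hp.leadingCoeff, hq.leadingCoeff, mul_one, eq_comm] at this

variable {A B : F[X]} (hAB : IsInvPair α (φ α) d A B)

include h in
theorem IsConjElement.conj_pow_half {e : ℕ} (hde : d = e + e) : φ α ^ e = - α ^ e := by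
  have hd := h.pow_eq
  have h0 := h.pos
  have hne := h.pow_ne e (by omega) (by omega)
  rw [hde, pow_add, pow_add] at hd
  have : (α ^ e - φ α ^ e) * (φ α ^ e + α ^ e) = 0 := by linear_combination hd
  rw [mul_eq_zero, or_iff_right (sub_ne_zero.mpr hne)] at this
  exact eq_neg_of_add_eq_zero_left this

include h in
theorem IsConjElement.neg_ne {e : ℕ} (hde : d = e + e) {m : F} {i : ℕ}
    (hm : algebraMap F E m = α ^ i) : -m ≠ m := by
  have h0 := h.pos
  intro hmm
  apply h.pow_ne e (by omega) (by omega)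
  rw [h.conj_pow_half hde, eq_neg_iff_add_eq_zero, ← two_mul]
  have h1 := congrArg (algebraMap F E) hmm
  rw [map_neg, hm, neg_eq_iff_add_eq_zero, ← two_mul] at h1
  rw [(mul_eq_zero.mp h1).resolve_right (pow_ne_zero _ h.ne_zero), zero_mul]

include h hs ht hAB

theorem IsInvPair.homSubst_pow_mul {e k : ℕ} (hde : d = e + e) {m : F}
    (hm : algebraMap F E m = α ^ (d * (k + 1))) (a : F[X]) :
    homSubst (d * (k + 1)) (C s * X - C t) X
        ((X ^ 2 - C s * X + C t) ^ e * homSubst k A B a) =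
      C (-m) * ((X ^ 2 - C s * X + C t) ^ e * homSubst k A B a) := by
  apply map_injective _ (algebraMap F E).injective
  have hd : d * (k + 1) = e + (e + d * k) := by rw [hde]; ring
  have := mob_eq_of_eq h.pos h.pow_eq e e k (ι a)
  rw [map_homSubst_eq_mob hs ht, Polynomial.map_mul, Polynomial.map_mul, Polynomial.map_pow,
    map_X_sq_sub_add hs ht, hAB.map_homSubst, mul_pow, mul_assoc, hd, this, map_C, map_neg, hm,
    h.conj_pow_half hde, hd, Polynomial.map_mul, Polynomial.map_pow, map_X_sq_sub_add hs ht,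
    hAB.map_homSubst, mul_pow, mul_assoc]
  congr 2
  ring

theorem IsInvPair.exists_of_homSubst_eq_neg {e k : ℕ} (hde : d = e + e) {m : F}
    (hm : algebraMap F E m = α ^ (d * (k + 1))) {w : F[X]} (hw : w.natDegree ≤ d * (k + 1))
    (hT : homSubst (d * (k + 1)) (C s * X - C t) X w = C (-m) * w) :
    ∃ a : F[X], a.natDegree ≤ k ∧ w = (X ^ 2 - C s * X + C t) ^ e * homSubst k A B a := by
  have hd : d * (k + 1) = e + (e + d * k) := by rw [hde]; ring
  have h0 := h.pos
  obtain ⟨r, hr, he⟩ := exists_eq_of_mob_eq h.ne_zero h.conj_ne_zero h.ne.symm h.pos h.pow_eq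
    h.pow_ne (c := e) (c' := e) (by omega) (by omega) k (p := ι w)
    (natDegree_map_le.trans (hw.trans hd.le)) (by
      rw [← hd, ← map_homSubst_eq_mob hs ht, hT, Polynomial.map_mul, map_C, map_neg, hm,
        h.conj_pow_half hde, hd, pow_add α e, neg_mul])
  rw [← mul_assoc, ← mul_pow, ← map_X_sq_sub_add hs ht, ← Polynomial.map_pow] at he
  have hdvd : (X ^ 2 - C s * X + C t) ^ e ∣ w := by
    rw [← map_dvd_map _ (algebraMap F E).injective ((monic_X_sq_sub_add s t).pow e)]
    exact ⟨_, he⟩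
  obtain ⟨u, rfl⟩ := hdvd
  rw [Polynomial.map_mul] at he
  have hne : ι ((X ^ 2 - C s * X + C t) ^ e) ≠ 0 :=
    Polynomial.map_ne_zero ((monic_X_sq_sub_add s t).pow e).ne_zero
  obtain ⟨a, ha, -, rfl⟩ := hAB.exists_of_map_eq h hr (mul_left_cancel₀ hne he)
  exact ⟨a, ha, rfl⟩

omit hAB in
/-- The stable pencils on which the action is not scalar, when the order is even. -/
theorem card_nonscalar_pencil {k : ℕ} (hd : Even d) {m : F}
    (hm : algebraMap F E m = α ^ (d * (k + 1))) :
    Nat.card {W : Submodule F F[X] // (IsPencil (d * (k + 1)) W ∧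
        ∀ w ∈ W, homSubst (d * (k + 1)) (C s * X - C t) X w ∈ W) ∧
        ¬ ∀ w ∈ W, homSubst (d * (k + 1)) (C s * X - C t) X w = C m * w} =
      Nat.card {ab : F[X] × F[X] // ab.1.Monic ∧ ab.2.Monic ∧ FormCoprime k (k + 1) ab.1 ab.2 ∧
        (ι ab.2).eval α ≠ 0} := by
  obtain ⟨e, hde⟩ := hd
  obtain ⟨A, B, hAB⟩ := h.exists_isInvPair
  have hd0 := h.pos
  have he0 : e ≠ 0 := by omega
  have hn1 : 1 ≤ d * (k + 1) := Nat.mul_pos hd0 k.succ_pos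
  have hm0 : m ≠ 0 := by
    rintro rfl
    rw [map_zero] at hm
    exact pow_ne_zero _ h.ne_zero hm.symm
  have hne := h.neg_ne hde hm
  let N : F[X] := X ^ 2 - C s * X + C t
  have hN : N.Monic := monic_X_sq_sub_add s t
  have hNe0 : N ^ e ≠ 0 := (hN.pow e).ne_zero
  have hNe : (N ^ e).natDegree = d := by
    rw [natDegree_pow, natDegree_X_sq_sub_add, hde, mul_two]
  have hNα : (ι N).eval α = 0 := by rw [map_X_sq_sub_add hs ht]; simp
  let w (a : F[X]) : F[X] := N ^ e * homSubst k A B a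
  let v (b : F[X]) : F[X] := homSubst (k + 1) A B b
  have hwdeg (a : F[X]) : (w a).natDegree ≤ d * (k + 1) := by
    rw [mul_add, mul_one, add_comm]
    exact natDegree_mul_le.trans (add_le_add hNe.le (hAB.natDegree_le h k a))
  have hwcoeff (a : F[X]) : (w a).coeff (d * (k + 1)) = a.coeff k := by
    rw [mul_add, mul_one, add_comm, coeff_mul_add_eq_of_natDegree_le hNe.le
      (hAB.natDegree_le h k a), hAB.coeff h]
    nth_rw 1 [← hNe]
    rw [(hN.pow e).coeff_natDegree, one_mul]
  have hwα (a : F[X]) : (ι (w a)).eval α = 0 := by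
    simp only [w, Polynomial.map_mul, Polynomial.map_pow, eval_mul, eval_pow, hNα, zero_pow he0,
      zero_mul]
  have hvα {b : F[X]} (hb : b.natDegree ≤ k + 1) : (ι (v b)).eval α = 0 ↔ (ι b).eval α = 0 := by
    rw [hAB.map_homSubst, h.eval_invSubst (natDegree_map_le.trans hb)]
  have hwT (a : F[X]) : homSubst (d * (k + 1)) (C s * X - C t) X (w a) = C (-m) * w a :=
    hAB.homSubst_pow_mul h hs ht hde hm a
  have hvT (b : F[X]) : homSubst (d * (k + 1)) (C s * X - C t) X (v b) = C m * v b :=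
    hAB.homSubst_homSubst h hs ht hm b
  have hwC (x : F) (a : F[X]) : w (C x * a) = C x * w a := by
    simp only [w, ← smul_eq_C_mul, map_smul, mul_smul_comm]
  have hvC (x : F) (b : F[X]) : v (C x * b) = C x * v b := by
    simp only [v, ← smul_eq_C_mul, map_smul]
  have hwinj {a a' : F[X]} (ha : a.natDegree ≤ k) (ha' : a'.natDegree ≤ k) (heq : w a = w a') :
      a = a' := hAB.injective h ha ha' (mul_left_cancel₀ hNe0 heq)
  symm
  refine Nat.card_congr (Equiv.ofBijective
    (fun ab ↦ ⟨Submodule.span F {w ab.1.1, v ab.1.2}, ⟨?_, ?_⟩, ?_⟩) ⟨?_, ?_⟩)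
  · obtain ⟨⟨a, b⟩, -, -, hab, hbα⟩ := ab
    refine ⟨_, _, ⟨hwdeg a, hAB.natDegree_le h _ b, ?_, ?_⟩, rfl⟩
    · refine IsCoprime.mul_left (IsCoprime.pow_left (isCoprime_X_sq_sub_add hs ht ?_))
        (hab.isCoprime_homSubst (hAB.isCoprime h))
      rwa [Ne, hvα hab.2.1]
    · rw [hwcoeff, hAB.coeff h]
      exact hab.2.2.2
  · intro z hz
    obtain ⟨x, y, rfl⟩ := mem_span_pair_iff.mp hz
    rw [map_add, homSubst_C_mul, homSubst_C_mul, hwT, hvT, ← C_eq_algebraMap, ← C_eq_algebraMap]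
    exact mem_span_pair_iff.mpr ⟨x * -m, y * m, by rw [C_mul, C_mul]; ring⟩
  · obtain ⟨⟨a, b⟩, ha, -, hab, hbα⟩ := ab
    intro hsc
    have h1 := hsc _ (Submodule.subset_span (Set.mem_insert _ _))
    rw [hwT] at h1
    have h2 : w a ≠ 0 := fun h0 ↦ ha.ne_zero
      (hwinj hab.1 (natDegree_zero.trans_le k.zero_le) (h0.trans (by simp [w])))
    exact hne (C_injective (mul_right_cancel₀ h2 h1))
  · rintro ⟨⟨a, b⟩, ha, hb, hab, hbα⟩ ⟨⟨a', b'⟩, ha', hb', hab', hbα'⟩ heq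
    rw [Subtype.mk.injEq] at heq
    have hw : w a ∈ Submodule.span F {w a', v b'} :=
      heq ▸ Submodule.subset_span (Set.mem_insert _ _)
    have hv : v b ∈ Submodule.span F {w a', v b'} :=
      heq ▸ Submodule.subset_span (Set.mem_insert_of_mem _ rfl)
    obtain ⟨x, y, hxy⟩ := mem_span_pair_iff.mp hw
    obtain ⟨x', y', hxy'⟩ := mem_span_pair_iff.mp hv
    have hy := congrArg (fun p ↦ (ι p).eval α) hxy
    simp only [Polynomial.map_add, Polynomial.map_mul, map_C, eval_add, eval_C_mul, hwα, mul_zero,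
      zero_add, mul_eq_zero, hvα hab'.2.1, hbα', or_false] at hy
    rw [map_eq_zero] at hy
    rw [hy, C_0, zero_mul, add_zero, ← hwC] at hxy
    have haa := hwinj hab.1 ((natDegree_C_mul_le _ _).trans hab'.1) hxy.symm
    rw [eq_one_of_monic ha ha' haa, C_1, one_mul] at haa
    have hT := congrArg (homSubst (d * (k + 1)) (C s * X - C t) X) hxy'
    rw [map_add, homSubst_C_mul, homSubst_C_mul, hwT, hvT, hvT, ← C_eq_algebraMap,
      ← C_eq_algebraMap] at hT
    have hx : C (x' * (-m - m)) * w a' = 0 := by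
      rw [C_mul, C_sub]
      linear_combination hT - C m * hxy'
    have hwa : w a' ≠ 0 := fun h0 ↦ ha'.ne_zero
      (hwinj hab'.1 (natDegree_zero.trans_le k.zero_le) (h0.trans (by simp [w])))
    rw [mul_eq_zero, or_iff_left hwa, C_eq_zero, mul_eq_zero,
      or_iff_left (sub_ne_zero.mpr hne)] at hx
    rw [hx, C_0, zero_mul, zero_add, ← hvC] at hxy'
    have hbb := hAB.injective h hab.2.1 ((natDegree_C_mul_le _ _).trans hab'.2.1) hxy'.symm
    rw [eq_one_of_monic hb hb' hbb, C_1, one_mul] at hbb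
    exact Subtype.ext (Prod.ext haa hbb)
  · rintro ⟨W, ⟨hW, hst⟩, hns⟩
    obtain ⟨-, w', v', rfl, hw0, hv0, hwm, hvm⟩ := h.exists_of_not_scalar hs ht hn1 hm hW hst hns
    have hP := hW.formCoprime
    obtain ⟨a, ha, rfl⟩ := hAB.exists_of_homSubst_eq_neg h hs ht hde hm hP.1 hwm
    obtain ⟨b, hb, rfl⟩ := hAB.exists_of_homSubst_eq h hs ht hm hP.2.1 hvm
    have ha0 : a ≠ 0 := by rintro rfl; simp at hw0
    have hbα : (ι b).eval α ≠ 0 := by rwa [Ne, ← hvα hb]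
    have hb0 : b ≠ 0 := by rintro rfl; simp at hbα
    have hab : FormCoprime k (k + 1) a b := by
      refine ⟨ha, hb, hAB.isCoprime_of_isCoprime h ha hb ha0 hP.2.2.1.of_mul_left_right, ?_⟩
      have := hP.2.2.2
      rwa [hAB.coeff h, hwcoeff] at this
    have hx := inv_ne_zero (leadingCoeff_ne_zero.mpr ha0)
    have hy := inv_ne_zero (leadingCoeff_ne_zero.mpr hb0)
    refine ⟨⟨(_, _), monic_C_inv_mul ha0, monic_C_inv_mul hb0, hab.C_mul hx hy, ?_⟩,
      Subtype.ext ?_⟩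
    · rw [Polynomial.map_mul, map_C, eval_C_mul]
      exact mul_ne_zero ((_root_.map_ne_zero _).mpr hy) hbα
    · simp only [hwC, hvC]
      exact span_pair_C_mul hx hy _ _

end NonScalarPencil

/-! ### Counting coprime pairs -/

theorem card_subtype_add_card_subtype {T : Type*} (P Q : T → Prop) [Finite {x // P x ∧ Q x}]
    [Finite {x // P x ∧ ¬ Q x}] :
    Nat.card {x // P x ∧ Q x} + Nat.card {x // P x ∧ ¬ Q x} = Nat.card {x // P x} := by
  classical
  rw [← Nat.card_sum]
  exact Nat.card_congr (((Equiv.subtypeSubtypeEquivSubtypeInter P Q).symm.sumCongr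
    (Equiv.subtypeSubtypeEquivSubtypeInter P fun x ↦ ¬ Q x).symm).trans
    (Equiv.sumCompl fun x : Subtype P ↦ Q x.1))

/-- The coprime pairs of a monic polynomial of degree `n` and a polynomial of degree less
than `n`. -/
def coprimePairs (k : Type*) [Field k] (n : ℕ) : Set (k[X] × k[X]) :=
  {p | p.1.Monic ∧ p.1.natDegree = n ∧ p.2 ∈ degreeLT k n ∧ IsCoprime p.1 p.2}

section Count

variable {k : Type*} [Field k] {n : ℕ}

theorem card_degreeLT : Nat.card (degreeLT k n) = Nat.card k ^ n := by
  rw [Nat.card_congr (degreeLTEquiv k n).toEquiv, Nat.card_fun, Nat.card_fin]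

theorem card_monic : Nat.card {p : k[X] // p.Monic ∧ p.natDegree = n} = Nat.card k ^ n := by
  rw [Nat.card_congr (monicEquivDegreeLT n), card_degreeLT]

theorem coeff_eq_zero_of_mem_degreeLT {p : k[X]} (hp : p ∈ degreeLT k n) : p.coeff n = 0 :=
  coeff_eq_zero_of_degree_lt (mem_degreeLT.mp hp)

theorem mem_degreeLT_of_coeff_eq_zero {p : k[X]} (hp : p.natDegree ≤ n) (hpn : p.coeff n = 0) :
    p ∈ degreeLT k n := by
  rw [mem_degreeLT, degree_lt_iff_coeff_zero]
  intro m hm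
  rcases hm.eq_or_lt with rfl | hm
  · exact hpn
  · exact coeff_eq_zero_of_natDegree_lt (hp.trans_lt hm)

theorem natDegree_le_of_mem_degreeLT {p : k[X]} (hp : p ∈ degreeLT k n) : p.natDegree ≤ n :=
  natDegree_le_of_degree_le (mem_degreeLT.mp hp).le

theorem mul_mem_degreeLT_iff {g p : k[X]} (hg : g.Monic) :
    g * p ∈ degreeLT k (g.natDegree + n) ↔ p ∈ degreeLT k n := by
  rw [mem_degreeLT, mem_degreeLT, degree_mul, degree_eq_natDegree hg.ne_zero, Nat.cast_add,
    WithBot.add_lt_add_iff_left (WithBot.natCast_ne_bot _)]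

theorem exists_eq_mul_isCoprime {a : k[X]} (ha : a ≠ 0) (b : k[X]) :
    ∃ g a' b' : k[X], g.Monic ∧ a = g * a' ∧ b = g * b' ∧ IsCoprime a' b' := by
  classical
  obtain ⟨a₁, ha₁⟩ := EuclideanDomain.gcd_dvd_left a b
  obtain ⟨b₁, hb₁⟩ := EuclideanDomain.gcd_dvd_right a b
  have hg := EuclideanDomain.gcd_eq_gcd_ab a b
  set g := EuclideanDomain.gcd a b
  have hg0 : g ≠ 0 := by
    rintro h0
    rw [h0, zero_mul] at ha₁
    exact ha ha₁
  have hc := leadingCoeff_ne_zero.mpr hg0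
  have hC : C g.leadingCoeff⁻¹ * C g.leadingCoeff = 1 := by
    rw [← C_mul, inv_mul_cancel₀ hc, C_1]
  refine ⟨C g.leadingCoeff⁻¹ * g, C g.leadingCoeff * a₁, C g.leadingCoeff * b₁,
    monic_C_inv_mul hg0, ?_, ?_, ?_⟩
  · linear_combination ha₁ - g * a₁ * hC
  · linear_combination hb₁ - g * b₁ * hC
  · rw [isCoprime_mul_unit_left_left (isUnit_C.mpr hc.isUnit),
      isCoprime_mul_unit_left_right (isUnit_C.mpr hc.isUnit)]
    refine ⟨EuclideanDomain.gcdA a b, EuclideanDomain.gcdB a b, mul_left_cancel₀ hg0 ?_⟩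
    linear_combination -hg - EuclideanDomain.gcdA a b * ha₁ - EuclideanDomain.gcdB a b * hb₁

theorem dvd_of_mul_eq_mul_of_isCoprime {g g' a a' b b' : k[X]} (ha : g * a = g' * a')
    (hb : g * b = g' * b') (hab : IsCoprime a' b') : g ∣ g' := by
  obtain ⟨u, v, huv⟩ := hab
  exact ⟨u * a + v * b, by linear_combination -g' * huv - u * ha - v * hb⟩

theorem card_coprimePairs_zero : Nat.card (coprimePairs k 0) = 1 := by
  have : coprimePairs k 0 = {(1, 0)} := by
    ext ⟨a, b⟩
    simp only [coprimePairs, Set.mem_ofPred_eq, Set.mem_singleton_iff, Prod.mk.injEq, mem_degreeLT]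
    constructor
    · rintro ⟨ha, ha0, hb, -⟩
      exact ⟨ha.natDegree_eq_zero.mp ha0, by simpa using hb⟩
    · rintro ⟨rfl, rfl⟩
      simpa using isCoprime_one_left
  rw [this]
  simp

variable [Finite k]

instance : Finite (degreeLT k n) := .of_equiv _ (degreeLTEquiv k n).symm.toEquiv

instance : Finite {p : k[X] // p.Monic ∧ p.natDegree = n} :=
  .of_equiv _ (monicEquivDegreeLT n).symm

instance : Finite (coprimePairs k n) :=
  .of_injective (fun p ↦ ((⟨p.1.1, p.2.1, p.2.2.1⟩, ⟨p.1.2, p.2.2.2.1⟩) :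
    {p : k[X] // p.Monic ∧ p.natDegree = n} × degreeLT k n)) fun p p' h ↦ by
      rw [Prod.mk.injEq, Subtype.mk.injEq, Subtype.mk.injEq] at h
      exact Subtype.ext (Prod.ext h.1 h.2)

theorem sum_card_coprimePairs :
    ∑ l ∈ Finset.range (n + 1), Nat.card k ^ l * Nat.card (coprimePairs k (n - l)) =
      Nat.card k ^ (2 * n) := by
  have key : Nat.card (Σ l : Fin (n + 1), {p : k[X] // p.Monic ∧ p.natDegree = l} ×
      coprimePairs k (n - l)) =
      Nat.card ({p : k[X] // p.Monic ∧ p.natDegree = n} × degreeLT k n) := by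
    refine Nat.card_congr (Equiv.ofBijective (fun x ↦
      (⟨x.2.1.1 * x.2.2.1.1, x.2.1.2.1.mul x.2.2.2.1, ?_⟩, ⟨x.2.1.1 * x.2.2.1.2, ?_⟩)) ⟨?_, ?_⟩)
    · rw [x.2.1.2.1.natDegree_mul x.2.2.2.1, x.2.1.2.2, x.2.2.2.2.1]
      omega
    · have := (mul_mem_degreeLT_iff x.2.1.2.1).mpr x.2.2.2.2.2.1
      rwa [x.2.1.2.2, Nat.add_sub_cancel' (by omega)] at this
    · rintro ⟨l, ⟨g, hg, hgl⟩, ⟨a, b⟩, _, _, _, hab⟩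
        ⟨l', ⟨g', hg', hgl'⟩, ⟨a', b'⟩, _, _, _, hab'⟩ heq
      simp only [Prod.mk.injEq, Subtype.mk.injEq] at heq
      obtain ⟨h1, h2⟩ := heq
      obtain rfl : g = g' := eq_of_monic_of_associated hg hg' (associated_of_dvd_dvd
        (dvd_of_mul_eq_mul_of_isCoprime h1 h2 hab')
        (dvd_of_mul_eq_mul_of_isCoprime h1.symm h2.symm hab))
      obtain rfl : l = l' := Fin.ext (hgl.symm.trans hgl')
      obtain rfl := mul_left_cancel₀ hg.ne_zero h1
      obtain rfl := mul_left_cancel₀ hg.ne_zero h2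
      rfl
    · rintro ⟨⟨a, ha, han⟩, b, hb⟩
      obtain ⟨g, a', b', hg, rfl, rfl, hab⟩ := exists_eq_mul_isCoprime ha.ne_zero b
      have ha' := hg.of_mul_monic_left ha
      rw [hg.natDegree_mul ha'] at han
      have hb' : b' ∈ degreeLT k (n - g.natDegree) := by
        rw [← mul_mem_degreeLT_iff hg, Nat.add_sub_cancel' (by omega)]
        exact hb
      exact ⟨⟨⟨g.natDegree, by omega⟩, ⟨g, hg, rfl⟩, (a', b'), ha', by simp only; omega, hb', hab⟩,
        rfl⟩
  rw [Nat.card_prod, card_monic, card_degreeLT, Nat.card_sigma, ← pow_add, ← two_mul] at key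
  rw [← key, Finset.sum_range]
  exact Finset.sum_congr rfl fun l _ ↦ by rw [Nat.card_prod, card_monic]

theorem card_coprimePairs_succ :
    Nat.card (coprimePairs k (n + 1)) + Nat.card k ^ (2 * n + 1) = Nat.card k ^ (2 * n + 2) := by
  have h1 := sum_card_coprimePairs (k := k) (n := n + 1)
  rw [Finset.sum_range_succ', pow_zero, one_mul, Nat.sub_zero] at h1
  rw [pow_succ, ← sum_card_coprimePairs, Finset.sum_mul, add_comm]
  refine (congrArg (· + _) (Finset.sum_congr rfl fun l _ ↦ ?_)).trans h1
  rw [Nat.add_sub_add_right]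
  ring

end Count

section CountPencil

variable {k : Type*} [Field k] {n : ℕ}

theorem coeff_fst_of_mem_coprimePairs {p : k[X] × k[X]} (hp : p ∈ coprimePairs k n) :
    p.1.coeff n = 1 := by
  rw [← hp.2.1]
  exact hp.1.coeff_natDegree

theorem formCoprime_of_mem_coprimePairs {p : k[X] × k[X]} (hp : p ∈ coprimePairs k n) :
    FormCoprime n n p.1 p.2 := by
  refine ⟨hp.2.1.le, natDegree_le_of_mem_degreeLT hp.2.2.1, hp.2.2.2, .inl ?_⟩
  rw [coeff_fst_of_mem_coprimePairs hp]
  exact one_ne_zero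

theorem snd_ne_zero_of_mem_coprimePairs (hn : 1 ≤ n) {p : k[X] × k[X]}
    (hp : p ∈ coprimePairs k n) : p.2 ≠ 0 :=
  (formCoprime_of_mem_coprimePairs hp).ne_zero_right hn

theorem C_mul_mem_coprimePairs {a b : k[X]} {y : k} (hy : y ≠ 0) :
    (a, C y * b) ∈ coprimePairs k n ↔ (a, b) ∈ coprimePairs k n := by
  simp only [coprimePairs, Set.mem_ofPred_eq, mem_degreeLT, degree_C_mul hy,
    isCoprime_mul_unit_left_right (isUnit_C.mpr hy.isUnit)]

theorem add_C_mul_mem_coprimePairs {a b : k[X]} (x : k) (hab : (a, b) ∈ coprimePairs k n) :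
    (a + C x * b, b) ∈ coprimePairs k n := by
  obtain ⟨ha, han, hb, hab⟩ := hab
  have hlt : (C x * b).degree < a.degree := by
    rw [degree_eq_natDegree ha.ne_zero, han]
    exact mem_degreeLT.mp (smul_eq_C_mul (p := b) x ▸ Submodule.smul_mem _ x hb)
  exact ⟨ha.add_of_left hlt, (natDegree_add_eq_left_of_degree_lt hlt).trans han, hb,
    IsCoprime.add_mul_right_left_iff.mpr hab⟩

theorem card_monic_coprimePairs_mul (hn : 1 ≤ n) :
    Nat.card {p // p ∈ coprimePairs k n ∧ p.2.Monic} * Nat.card kˣ =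
      Nat.card (coprimePairs k n) := by
  rw [← Nat.card_prod]
  refine Nat.card_congr (Equiv.ofBijective (fun p ↦ ⟨(p.1.1.1, C (p.2 : k) * p.1.1.2),
    (C_mul_mem_coprimePairs p.2.ne_zero).mpr p.1.2.1⟩) ⟨?_, ?_⟩)
  · rintro ⟨⟨⟨a, b⟩, _, hb⟩, y⟩ ⟨⟨⟨a', b'⟩, _, hb'⟩, y'⟩ heq
    simp only [Subtype.mk.injEq, Prod.mk.injEq] at heq
    obtain ⟨rfl, h2⟩ := heq
    have hy := congrArg leadingCoeff h2
    simp only [leadingCoeff_mul, leadingCoeff_C, hb.leadingCoeff, hb'.leadingCoeff, mul_one] at hy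
    obtain rfl := Units.ext hy
    obtain rfl := mul_left_cancel₀ (C_ne_zero.mpr y.ne_zero) h2
    rfl
  · rintro ⟨⟨a, b⟩, hab⟩
    have hb := leadingCoeff_ne_zero.mpr (snd_ne_zero_of_mem_coprimePairs hn hab)
    refine ⟨(⟨(a, C b.leadingCoeff⁻¹ * b), (C_mul_mem_coprimePairs (inv_ne_zero hb)).mpr hab,
      monic_C_inv_mul (leadingCoeff_ne_zero.mp hb)⟩, Units.mk0 _ hb), ?_⟩
    simp [← mul_assoc, ← C_mul, mul_inv_cancel₀ hb]

theorem IsPencil.exists_coprimePairs (hn : 1 ≤ n) {W : Submodule k k[X]} (hW : IsPencil n W) :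
    ∃ p, (p ∈ coprimePairs k n ∧ p.2.Monic) ∧ W = Submodule.span k {p.1, p.2} := by
  obtain ⟨P, Q, hPQ, hWe⟩ := id hW
  have key {P Q : k[X]} (hPQ : FormCoprime n n P Q) (hP : P.coeff n ≠ 0)
      (hWe : W = Submodule.span k {P, Q}) :
      ∃ p, (p ∈ coprimePairs k n ∧ p.2.Monic) ∧ W = Submodule.span k {p.1, p.2} := by
    have hdeg : P.natDegree = n := natDegree_eq_of_le_of_coeff_ne_zero hPQ.1 hP
    have hP' : P.leadingCoeff = P.coeff n := by rw [leadingCoeff, hdeg]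
    have hP0 : P ≠ 0 := by rintro rfl; simp at hP
    let a := C P.leadingCoeff⁻¹ * P
    let b := Q - C (Q.coeff n) * a
    have ha : a.Monic := monic_C_inv_mul hP0
    have hx : P.leadingCoeff⁻¹ ≠ 0 := inv_ne_zero (leadingCoeff_ne_zero.mpr hP0)
    have han : a.natDegree = n := (natDegree_C_mul hx).trans hdeg
    have haQ : IsCoprime a Q :=
      (isCoprime_mul_unit_left_left (isUnit_C.mpr hx.isUnit) _ _).mpr hPQ.2.2.1
    have hab : (a, b) ∈ coprimePairs k n := by
      refine ⟨ha, han, mem_degreeLT_of_coeff_eq_zero ?_ ?_, ?_⟩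
      · exact (natDegree_sub_le_of_le hPQ.2.1
          ((natDegree_C_mul_le _ _).trans han.le)).trans (max_self n).le
      · have := ha.coeff_natDegree
        rw [han] at this
        simp only [b, coeff_sub, coeff_C_mul, this, mul_one, sub_self]
      · have : b = Q + a * -C (Q.coeff n) := by simp only [b]; ring
        simp only [this]
        exact IsCoprime.add_mul_left_right_iff.mpr haQ
    have hb := snd_ne_zero_of_mem_coprimePairs hn hab
    have hy := inv_ne_zero (leadingCoeff_ne_zero.mpr hb)
    refine ⟨(a, C b.leadingCoeff⁻¹ * b), ⟨(C_mul_mem_coprimePairs hy).mpr hab,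
      monic_C_inv_mul hb⟩, ?_⟩
    have h1 := span_pair_C_mul one_ne_zero hy a b
    rw [C_1, one_mul] at h1
    have hpen : IsPencil n (Submodule.span k {a, b}) :=
      ⟨a, b, formCoprime_of_mem_coprimePairs hab, rfl⟩
    rw [h1]
    refine (hpen.eq_of_le hn hW ?_).symm
    rw [Submodule.span_le, Set.insert_subset_iff, Set.singleton_subset_iff, hWe]
    have haW : a ∈ Submodule.span k {P, Q} :=
      mem_span_pair_iff.mpr ⟨P.leadingCoeff⁻¹, 0, by simp [a]⟩
    refine ⟨haW, Submodule.sub_mem _ (Submodule.subset_span (Set.mem_insert_of_mem _ rfl)) ?_⟩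
    rw [← smul_eq_C_mul]
    exact Submodule.smul_mem _ _ haW
  rcases hPQ.2.2.2 with hP | hQ
  · exact key hPQ hP hWe
  · exact key hPQ.symm hQ (by rw [hWe, Set.pair_comm])

theorem card_pencil_mul (hn : 1 ≤ n) :
    Nat.card {W : Submodule k k[X] // IsPencil n W} * Nat.card k =
      Nat.card {p // p ∈ coprimePairs k n ∧ p.2.Monic} := by
  rw [← Nat.card_prod]
  choose g hg hspan using fun W : {W : Submodule k k[X] // IsPencil n W} ↦
    W.2.exists_coprimePairs hn
  have hmem {p : k[X] × k[X]} (hp : p ∈ coprimePairs k n) :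
      IsPencil n (Submodule.span k {p.1, p.2}) := ⟨_, _, formCoprime_of_mem_coprimePairs hp, rfl⟩
  refine Nat.card_congr (Equiv.ofBijective (fun x ↦ ⟨((g x.1).1 + C x.2 * (g x.1).2, (g x.1).2),
    add_C_mul_mem_coprimePairs x.2 (hg x.1).1, (hg x.1).2⟩) ⟨?_, ?_⟩)
  · rintro ⟨W, x⟩ ⟨W', x'⟩ heq
    simp only [Subtype.mk.injEq, Prod.mk.injEq] at heq
    obtain ⟨h1, h2⟩ := heq
    have hle : W.1 ≤ W'.1 := by
      rw [hspan W, hspan W', Submodule.span_le, Set.insert_subset_iff, Set.singleton_subset_iff]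
      exact ⟨mem_span_pair_iff.mpr ⟨1, x' - x, by
        rw [C_1, C_sub]; linear_combination -h1 + C x * h2⟩,
        mem_span_pair_iff.mpr ⟨0, 1, by simp [h2]⟩⟩
    obtain rfl : W = W' := Subtype.ext (W.2.eq_of_le hn W'.2 hle)
    rw [add_right_inj] at h1
    have := C_injective (mul_right_cancel₀ (snd_ne_zero_of_mem_coprimePairs hn (hg W).1) h1)
    rw [this]
  · rintro ⟨⟨a, b⟩, hab, hb⟩
    have hb : b.Monic := hb
    let W : {W : Submodule k k[X] // IsPencil n W} := ⟨_, hmem hab⟩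
    have haW : a ∈ W.1 := Submodule.subset_span (Set.mem_insert _ _)
    have hbW : b ∈ W.1 := Submodule.subset_span (Set.mem_insert_of_mem _ rfl)
    have ha1 := coeff_fst_of_mem_coprimePairs hab
    have hb1 := coeff_eq_zero_of_mem_degreeLT hab.2.2.1
    have hg1 := coeff_fst_of_mem_coprimePairs (hg W).1
    have hg2 := coeff_eq_zero_of_mem_degreeLT (hg W).1.2.2.1
    rw [hspan W] at haW hbW
    obtain ⟨x, y, hxy⟩ := mem_span_pair_iff.mp haW
    obtain ⟨x', y', hxy'⟩ := mem_span_pair_iff.mp hbW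
    have hx := congrArg (coeff · n) hxy
    have hx' := congrArg (coeff · n) hxy'
    simp only [coeff_add, coeff_C_mul, hg1, hg2, ha1, mul_one, mul_zero, add_zero] at hx
    simp only [coeff_add, coeff_C_mul, hg1, hg2, hb1, mul_one, mul_zero, add_zero] at hx'
    rw [hx', C_0, zero_mul, zero_add] at hxy'
    rw [eq_one_of_monic hb (hg W).2 hxy'.symm, C_1, one_mul] at hxy'
    rw [hx, C_1, one_mul] at hxy
    refine ⟨(W, y), Subtype.ext (Prod.ext hxy hxy')⟩

theorem card_monic_coprimePairs_zero :
    Nat.card {p // p ∈ coprimePairs k 0 ∧ p.2.Monic} = 0 := by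
  have : IsEmpty {p // p ∈ coprimePairs k 0 ∧ p.2.Monic} := by
    refine ⟨fun ⟨p, hp, hp2⟩ ↦ hp2.ne_zero ?_⟩
    simpa [mem_degreeLT] using hp.2.2.1
  exact Nat.card_of_isEmpty

variable [Finite k]

theorem card_monic_coprimePairs_succ :
    Nat.card {p // p ∈ coprimePairs k (n + 1) ∧ p.2.Monic} = Nat.card k ^ (2 * n + 1) := by
  have : Fintype k := Fintype.ofFinite k
  have h1 := card_monic_coprimePairs_mul (k := k) (Nat.le_add_left 1 n)
  have h2 := card_coprimePairs_succ (k := k) (n := n)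
  have hq : 1 < Nat.card k := Finite.one_lt_card
  rw [Nat.card_units] at h1
  rw [← h1] at h2
  obtain ⟨r, hr⟩ : ∃ r, Nat.card k = r + 1 := ⟨_, (Nat.sub_add_cancel hq.le).symm⟩
  rw [hr] at h2 hq ⊢
  rw [Nat.add_sub_cancel, pow_succ _ (2 * n + 1), mul_add, mul_one, add_left_inj] at h2
  exact Nat.eq_of_mul_eq_mul_right (Nat.lt_of_succ_lt_succ hq) h2

theorem card_pencil_succ :
    Nat.card {W : Submodule k k[X] // IsPencil (n + 1) W} = Nat.card k ^ (2 * n) := by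
  have h1 := card_pencil_mul (k := k) (Nat.le_add_left 1 n)
  rw [card_monic_coprimePairs_succ, pow_succ] at h1
  exact Nat.eq_of_mul_eq_mul_right Nat.card_pos h1

end CountPencil

section CountFormCoprime

theorem finite_subtype_of_imp {T : Type*} {P Q : T → Prop} (h : ∀ x, P x → Q x)
    [Finite {x // Q x}] : Finite {x // P x} :=
  .of_injective _ (Subtype.impEmbedding P Q h).injective

variable {k : Type*} [Field k] {n : ℕ}

theorem mem_degreeLT_succ_iff {p : k[X]} : p ∈ degreeLT k (n + 1) ↔ p.natDegree ≤ n := by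
  rw [mem_degreeLT, degree_lt_iff_coeff_zero, natDegree_le_iff_coeff_eq_zero]
  rfl

instance [Finite k] (i j : ℕ) : Finite {p : k[X] × k[X] // FormCoprime i j p.1 p.2} :=
  .of_injective (fun p ↦ ((⟨p.1.1, mem_degreeLT_succ_iff.mpr p.2.1⟩,
    ⟨p.1.2, mem_degreeLT_succ_iff.mpr p.2.2.1⟩) : degreeLT k (i + 1) × degreeLT k (j + 1)))
    fun p p' h ↦ by
      rw [Prod.mk.injEq, Subtype.mk.injEq, Subtype.mk.injEq] at h
      exact Subtype.ext (Prod.ext h.1 h.2)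

theorem formCoprime_succ_iff_of_natDegree_eq {a b : k[X]} (hb : b.Monic)
    (hbn : b.natDegree = n + 1) :
    FormCoprime n (n + 1) a b ↔ a ∈ degreeLT k (n + 1) ∧ IsCoprime b a := by
  rw [mem_degreeLT_succ_iff]
  have : b.coeff (n + 1) = 1 := hbn ▸ hb.coeff_natDegree
  exact ⟨fun h ↦ ⟨h.1, h.2.2.1.symm⟩, fun h ↦ ⟨h.1, hbn.le, h.2.symm, .inr (by simp [this])⟩⟩

theorem formCoprime_succ_iff_of_natDegree_ne {a b : k[X]} (ha : a.Monic)
    (hbn : b.natDegree ≠ n + 1) :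
    FormCoprime n (n + 1) a b ↔ a.natDegree = n ∧ b.natDegree ≤ n ∧ IsCoprime a b := by
  constructor
  · rintro ⟨h1, h2, h3, h4⟩
    have h2' : b.natDegree ≤ n := Nat.lt_succ_iff.mp (lt_of_le_of_ne h2 hbn)
    rw [coeff_eq_zero_of_natDegree_lt (n := n + 1) (Nat.lt_succ_of_le h2')] at h4
    exact ⟨natDegree_eq_of_le_of_coeff_ne_zero h1 (h4.resolve_right (by simp)), h2', h3⟩
  · rintro ⟨h1, h2, h3⟩
    have : a.coeff n = 1 := h1 ▸ ha.coeff_natDegree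
    exact ⟨h1.le, h2.trans n.le_succ, h3, .inl (by simp [this])⟩

variable [Finite k]

theorem card_monic_formCoprime_eq_add :
    Nat.card {p : k[X] × k[X] // p.1.Monic ∧ p.2.Monic ∧ FormCoprime n (n + 1) p.1 p.2} =
      Nat.card {p // p ∈ coprimePairs k (n + 1) ∧ p.2.Monic} + (Nat.card (coprimePairs k n) +
        Nat.card {p // p ∈ coprimePairs k n ∧ p.2.Monic}) := by
  let P (p : k[X] × k[X]) : Prop := p.1.Monic ∧ p.2.Monic ∧ FormCoprime n (n + 1) p.1 p.2
  have : Finite {p // P p} := finite_subtype_of_imp fun p hp ↦ hp.2.2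
  have h1 (Q : k[X] × k[X] → Prop) : Finite {p // P p ∧ Q p} :=
    finite_subtype_of_imp fun p hp ↦ hp.1
  have h2 (Q Q' : k[X] × k[X] → Prop) : Finite {p // (P p ∧ Q p) ∧ Q' p} :=
    finite_subtype_of_imp fun p hp ↦ hp.1
  rw [← card_subtype_add_card_subtype P fun p ↦ p.2.natDegree = n + 1,
    ← card_subtype_add_card_subtype (fun p ↦ P p ∧ ¬ p.2.natDegree = n + 1)
      fun p ↦ p.2.natDegree = n]
  congr 1
  · refine Nat.card_congr ((Equiv.prodComm _ _).subtypeEquiv ?_)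
    rintro ⟨a, b⟩
    simp only [P, coprimePairs, Set.mem_ofPred_eq, Equiv.prodComm_apply, Prod.swap_prod_mk]
    constructor
    · rintro ⟨⟨ha, hb, hab⟩, hbn⟩
      rw [formCoprime_succ_iff_of_natDegree_eq hb hbn] at hab
      exact ⟨⟨hb, hbn, hab⟩, ha⟩
    · rintro ⟨⟨hb, hbn, hab⟩, ha⟩
      exact ⟨⟨ha, hb, (formCoprime_succ_iff_of_natDegree_eq hb hbn).mpr hab⟩, hbn⟩
  congr 1
  · refine Nat.card_congr ((Equiv.prodShear (Equiv.refl _) Equiv.subRight).subtypeEquiv ?_)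
    rintro ⟨a, b⟩
    simp only [P, coprimePairs, Set.mem_ofPred_eq, Equiv.prodShear_apply, Equiv.refl_apply,
      Equiv.subRight_apply]
    have hcop : IsCoprime a (b - a) ↔ IsCoprime a b := by
      rw [show b - a = b + a * -1 by ring, IsCoprime.add_mul_left_right_iff]
    rw [hcop]
    constructor
    · rintro ⟨⟨⟨ha, hb, hab⟩, hbn⟩, hbn'⟩
      rw [formCoprime_succ_iff_of_natDegree_ne ha hbn] at hab
      have ha1 : a.coeff n = 1 := by rw [← hab.1]; exact ha.coeff_natDegree
      have hb1 : b.coeff n = 1 := by rw [← hbn']; exact hb.coeff_natDegree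
      exact ⟨ha, hab.1, mem_degreeLT_of_coeff_eq_zero
        ((natDegree_sub_le_of_le hab.2.1 hab.1.le).trans (max_self n).le)
        (by rw [coeff_sub, ha1, hb1, sub_self]), hab.2.2⟩
    · rintro ⟨ha, han, hba, hab⟩
      have hlt : (b - a).degree < a.degree := by
        rw [degree_eq_natDegree ha.ne_zero, han]
        exact mem_degreeLT.mp hba
      have hb : b.Monic := by simpa using ha.add_of_left hlt
      have hbn : b.natDegree = n := by
        have := natDegree_add_eq_left_of_degree_lt hlt
        rwa [add_sub_cancel, han] at this
      have hbn' : b.natDegree ≠ n + 1 := by omega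
      exact ⟨⟨⟨ha, hb, (formCoprime_succ_iff_of_natDegree_ne ha hbn').mpr ⟨han, hbn.le, hab⟩⟩,
        hbn'⟩, hbn⟩
  · refine Nat.card_congr (Equiv.subtypeEquivRight ?_)
    rintro ⟨a, b⟩
    simp only [P, coprimePairs, Set.mem_ofPred_eq]
    constructor
    · rintro ⟨⟨⟨ha, hb, hab⟩, hbn⟩, hbn'⟩
      rw [formCoprime_succ_iff_of_natDegree_ne ha hbn] at hab
      refine ⟨⟨ha, hab.1, ?_, hab.2.2⟩, hb⟩
      rw [mem_degreeLT, degree_eq_natDegree hb.ne_zero, Nat.cast_lt]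
      exact lt_of_le_of_ne hab.2.1 hbn'
    · rintro ⟨⟨ha, han, hbn, hab⟩, hb⟩
      rw [mem_degreeLT, degree_eq_natDegree hb.ne_zero, Nat.cast_lt] at hbn
      have hbn' : b.natDegree ≠ n + 1 := by omega
      exact ⟨⟨⟨ha, hb, (formCoprime_succ_iff_of_natDegree_ne ha hbn').mpr ⟨han, hbn.le, hab⟩⟩,
        hbn'⟩, hbn.ne⟩

theorem card_monic_formCoprime :
    Nat.card {p : k[X] × k[X] // p.1.Monic ∧ p.2.Monic ∧ FormCoprime n (n + 1) p.1 p.2} =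
      Nat.card k ^ (2 * n + 1) + Nat.card k ^ (2 * n) := by
  rw [card_monic_formCoprime_eq_add, card_monic_coprimePairs_succ]
  cases n with
  | zero => rw [card_coprimePairs_zero, card_monic_coprimePairs_zero, mul_zero, pow_zero, add_zero]
  | succ n => rw [card_monic_coprimePairs_succ, card_coprimePairs_succ]; rfl

end CountFormCoprime

section CountInvariant

variable {F E : Type*} [Field F] [Field E] [Algebra F E] {φ : E →ₐ[F] E} {α : E} {d n : ℕ}
  (h : IsConjElement φ α d) {s t : F} (hs : algebraMap F E s = α + φ α)
  (ht : algebraMap F E t = α * φ α)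

local notation "ι" => Polynomial.map (algebraMap F E)

include h hs ht in
theorem IsConjElement.dvd_of_eval_eq_zero {p : F[X]} (hp : (ι p).eval α = 0) :
    X ^ 2 - C s * X + C t ∣ p := by
  rw [← map_dvd_map _ (algebraMap F E).injective (monic_X_sq_sub_add s t), map_X_sq_sub_add hs ht]
  refine (isCoprime_X_sub_C_of_isUnit_sub (sub_ne_zero.mpr h.ne.symm).isUnit).mul_dvd ?_ ?_
  · rwa [dvd_iff_isRoot]
  · rw [dvd_iff_isRoot, IsRoot, eval_conj_map, hp, map_zero]

include hs ht in
theorem eval_X_sq_sub_add_mul (p : F[X]) : (ι ((X ^ 2 - C s * X + C t) * p)).eval α = 0 := by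
  rw [Polynomial.map_mul, map_X_sq_sub_add hs ht]
  simp

theorem coeff_X_sq_sub_add_mul (s t : F) {p : F[X]} (hp : p.natDegree ≤ n) :
    ((X ^ 2 - C s * X + C t) * p).coeff (n + 2) = p.coeff n := by
  have h2 : (X ^ 2 - C s * X + C t).coeff 2 = 1 := by simp
  rw [add_comm n, coeff_mul_add_eq_of_natDegree_le (natDegree_X_sq_sub_add s t).le hp, h2, one_mul]

variable [Finite F]

variable (F α) in
/-- The number of monic coprime pairs that parametrize the stable pencils on which the action is
not scalar. -/
noncomputable def nonscalarCount (n : ℕ) : ℕ :=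
  Nat.card {p : F[X] × F[X] // p.1.Monic ∧ p.2.Monic ∧ FormCoprime n (n + 1) p.1 p.2 ∧
    (ι p.2).eval α ≠ 0}

theorem card_eval_eq_zero_add :
    Nat.card {p : F[X] × F[X] // (p.1.Monic ∧ p.2.Monic ∧ FormCoprime n (n + 1) p.1 p.2) ∧
      (ι p.2).eval α = 0} + nonscalarCount F α n =
      Nat.card F ^ (2 * n + 1) + Nat.card F ^ (2 * n) := by
  let P (p : F[X] × F[X]) : Prop := p.1.Monic ∧ p.2.Monic ∧ FormCoprime n (n + 1) p.1 p.2
  have h1 (Q : F[X] × F[X] → Prop) : Finite {p // P p ∧ Q p} :=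
    finite_subtype_of_imp fun p hp ↦ hp.1.2.2
  rw [← card_monic_formCoprime, ← card_subtype_add_card_subtype P fun p ↦ (ι p.2).eval α = 0]
  congr 1
  refine Nat.card_congr (Equiv.subtypeEquivRight fun p ↦ ?_)
  simp only [P, and_assoc]

include h hs ht

theorem nonscalarCount_zero : nonscalarCount F α 0 = Nat.card F + 1 := by
  have : IsEmpty {p : F[X] × F[X] // (p.1.Monic ∧ p.2.Monic ∧ FormCoprime 0 (0 + 1) p.1 p.2) ∧
      (ι p.2).eval α = 0} := by
    refine ⟨fun ⟨p, hp, hp2⟩ ↦ ?_⟩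
    have h1 := natDegree_le_of_dvd (h.dvd_of_eval_eq_zero hs ht hp2) hp.2.1.ne_zero
    rw [natDegree_X_sq_sub_add] at h1
    have h2 := hp.2.2.2.1
    omega
  have h1 := card_eval_eq_zero_add (F := F) (α := α) (n := 0)
  rw [Nat.card_of_isEmpty] at h1
  simpa using h1

theorem nonscalarCount_succ : nonscalarCount F α n + nonscalarCount F α (n + 1) =
    Nat.card F ^ (2 * n + 3) + Nat.card F ^ (2 * n + 2) := by
  refine Eq.trans (congrArg (· + _) ?_) (card_eval_eq_zero_add (n := n + 1) (α := α))
  have hN := monic_X_sq_sub_add s t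
  refine Nat.card_congr (Equiv.ofBijective (fun p ↦ ⟨(p.1.2, (X ^ 2 - C s * X + C t) * p.1.1),
    ⟨p.2.2.1, hN.mul p.2.1, ?_⟩, eval_X_sq_sub_add_mul hs ht p.1.1⟩) ⟨?_, ?_⟩)
  · obtain ⟨⟨a, b⟩, ha, hb, hab, hbα⟩ := p
    refine ⟨hab.2.1, ?_, (isCoprime_X_sq_sub_add hs ht hbα).symm.mul_right hab.2.2.1.symm, ?_⟩
    · refine natDegree_mul_le.trans ?_
      rw [natDegree_X_sq_sub_add]
      have : a.natDegree ≤ n := hab.1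
      change 2 + a.natDegree ≤ n + 1 + 1
      omega
    · exact hab.2.2.2.symm.imp_right fun h0 ↦ (coeff_X_sq_sub_add_mul s t hab.1).trans_ne h0
  · rintro ⟨⟨a, b⟩, _⟩ ⟨⟨a', b'⟩, _⟩ heq
    simp only [Subtype.mk.injEq, Prod.mk.injEq] at heq
    exact Subtype.ext (Prod.ext (mul_left_cancel₀ hN.ne_zero heq.2) heq.1)
  · rintro ⟨⟨a, b⟩, ⟨ha, hb, hab⟩, hbα⟩
    obtain ⟨u, rfl⟩ := h.dvd_of_eval_eq_zero hs ht hbα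
    have hu : u.Monic := hN.of_mul_monic_left hb
    have hun : u.natDegree ≤ n := by
      have : ((X ^ 2 - C s * X + C t) * u).natDegree ≤ n + 1 + 1 := hab.2.1
      rw [hN.natDegree_mul hu, natDegree_X_sq_sub_add] at this
      omega
    have haα : (ι a).eval α ≠ 0 := fun h0 ↦ by
      have := hN.isUnit_iff.mp
        ((IsCoprime.of_mul_right_left hab.2.2.1).isUnit_of_dvd' (h.dvd_of_eval_eq_zero hs ht h0)
          dvd_rfl)
      simpa [this] using natDegree_X_sq_sub_add s t
    refine ⟨⟨(u, a), hu, ha, ⟨hun, hab.1, (IsCoprime.of_mul_right_right hab.2.2.1).symm,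
      hab.2.2.2.symm.imp_left fun h0 ↦ ?_⟩, haα⟩, rfl⟩
    rwa [← coeff_X_sq_sub_add_mul s t hun]

theorem cast_nonscalarCount : (nonscalarCount F α n : ℚ) =
    ((Nat.card F : ℚ) + 1) * ((Nat.card F : ℚ) ^ (2 * (n + 1)) - (-1) ^ (n + 1)) /
      ((Nat.card F : ℚ) ^ 2 + 1) := by
  have hq : ((Nat.card F : ℚ) ^ 2 + 1) ≠ 0 := by positivity
  rw [eq_div_iff hq]
  induction n with
  | zero => rw [nonscalarCount_zero h hs ht]; push_cast; ring
  | succ n ih =>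
    have h1 : (nonscalarCount F α n + nonscalarCount F α (n + 1) : ℚ) =
      (Nat.card F : ℚ) ^ (2 * n + 3) + (Nat.card F : ℚ) ^ (2 * n + 2) := by
        exact_mod_cast nonscalarCount_succ h hs ht
    linear_combination ((Nat.card F : ℚ) ^ 2 + 1) * h1 - ih

end CountInvariant

section CountConjCoprime

variable {F E : Type*} [Field F] [Field E] [Algebra F E] {φ : E →ₐ[F] E} {α : E} {d n : ℕ}

theorem monic_conj {p : E[X]} (hp : p.Monic) : (conj φ p).Monic := hp.map _

variable (φ α n) in
/-- The number of polynomials that parametrize the stable pencils whose degree is not divisible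
by `d`. -/
noncomputable def twistedCount : ℕ :=
  Nat.card {p : E[X] // p.Monic ∧ p.natDegree = n ∧ IsCoprime p (conj φ p) ∧ p.eval (φ α) ≠ 0}

theorem twistedCount_zero : twistedCount φ α 0 = 1 := by
  have : {p : E[X] | p.Monic ∧ p.natDegree = 0 ∧ IsCoprime p (conj φ p) ∧ p.eval (φ α) ≠ 0} =
      {1} := by
    ext p
    simp only [Set.mem_ofPred_eq, Set.mem_singleton_iff]
    constructor
    · rintro ⟨hp, hp0, _⟩
      exact hp.natDegree_eq_zero.mp hp0
    · rintro rfl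
      simpa using isCoprime_one_left
  have h1 : Nat.card {p : E[X] | p.Monic ∧ p.natDegree = 0 ∧ IsCoprime p (conj φ p) ∧
      p.eval (φ α) ≠ 0} = 1 := by rw [this]; simp
  exact h1

namespace IsConjElement

variable (h : IsConjElement φ α d)

include h

theorem card_monic_isCoprime_conj :
    Nat.card {p : E[X] // (p.Monic ∧ p.natDegree = n) ∧ IsCoprime p (conj φ p)} =
      Nat.card (coprimePairs F n) := by
  symm
  have hmem {a b : F[X]} {p : E[X]}
      (he : p = a.map (algebraMap F E) + C α * b.map (algebraMap F E)) :
      ((p.Monic ∧ p.natDegree = n) ∧ IsCoprime p (conj φ p)) ↔ (a, b) ∈ coprimePairs F n := by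
    have hlead : ((p.Monic ∧ p.natDegree = n) ↔ (p.natDegree ≤ n ∧ (p - X ^ n).coeff n = 0)) := by
      rw [coeff_sub, coeff_X_pow_self, sub_eq_zero]
      constructor
      · rintro ⟨hp, rfl⟩
        exact ⟨le_rfl, hp.coeff_natDegree⟩
      · rintro ⟨h1, h2⟩
        exact ⟨monic_of_natDegree_le_of_coeff_eq_one n h1 h2,
          natDegree_eq_of_le_of_coeff_ne_zero h1 (by simp [h2])⟩
    have he' : p - X ^ n = (a - X ^ n).map (algebraMap F E) + C α * b.map (algebraMap F E) := by
      rw [he, Polynomial.map_sub, Polynomial.map_pow, map_X]; ring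
    rw [hlead, h.natDegree_le_iff he, h.coeff_eq_zero_iff he', h.isCoprime_iff he, coeff_sub,
      coeff_X_pow_self, sub_eq_zero]
    constructor
    · rintro ⟨⟨⟨h1, h2⟩, h3, h4⟩, h5⟩
      exact ⟨monic_of_natDegree_le_of_coeff_eq_one n h1 h3,
        natDegree_eq_of_le_of_coeff_ne_zero h1 (by simp [h3]),
        mem_degreeLT_of_coeff_eq_zero h2 h4, h5⟩
    · rintro ⟨h1, h2, h3, h4⟩
      dsimp only at h1 h2
      exact ⟨⟨⟨h2.le, natDegree_le_of_mem_degreeLT h3⟩, h2 ▸ h1.coeff_natDegree,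
        coeff_eq_zero_of_mem_degreeLT h3⟩, h4⟩
  refine Nat.card_congr (Equiv.ofBijective (fun p ↦ ⟨p.1.1.map (algebraMap F E) +
    C α * p.1.2.map (algebraMap F E), (hmem rfl).mpr p.2⟩) ⟨?_, ?_⟩)
  · rintro ⟨⟨a, b⟩, _⟩ ⟨⟨a', b'⟩, _⟩ heq
    simp only [Subtype.mk.injEq] at heq
    have h0 : (0 : E[X]) = (a - a').map (algebraMap F E) + C α * (b - b').map (algebraMap F E) := by
      rw [Polynomial.map_sub, Polynomial.map_sub]
      linear_combination -heq
    have h1 (i : ℕ) := (h.coeff_eq_zero_iff h0 i).mp (coeff_zero i)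
    simp only [coeff_sub, sub_eq_zero] at h1
    exact Subtype.ext (Prod.ext (Polynomial.ext fun i ↦ (h1 i).1)
      (Polynomial.ext fun i ↦ (h1 i).2))
  · rintro ⟨p, hp⟩
    obtain ⟨a, b, rfl⟩ := h.exists_eq_add p
    exact ⟨⟨(a, b), (hmem rfl).mp hp⟩, rfl⟩

theorem isCoprime_conj_X_sub_C_mul_iff {p : E[X]} :
    IsCoprime ((X - C (φ α)) * conj φ p) (conj φ ((X - C (φ α)) * conj φ p)) ↔
      IsCoprime p (conj φ p) ∧ p.eval (φ α) ≠ 0 := by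
  have hX (x : E) : conj φ (X - C x) = X - C (φ x) := by rw [map_sub, conj_X, conj_C]
  rw [map_mul, h.conj_conj, hX, h.invol]
  constructor
  · intro hp
    refine ⟨hp.of_mul_left_right.of_mul_right_right.symm, fun h0 ↦ ?_⟩
    have h1 := hp.of_mul_left_left.of_mul_right_right.isUnit_of_dvd' dvd_rfl (dvd_iff_isRoot.mpr h0)
    exact not_isUnit_X_sub_C _ h1
  · rintro ⟨hp, h0⟩
    have h1 : IsCoprime (X - C α) (conj φ p) := isCoprime_X_sub_C (by
      rw [← h.invol α, eval_conj]
      exact (map_ne_zero φ).mpr h0)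
    exact ((isCoprime_X_sub_C_of_isUnit_sub (sub_ne_zero.mpr h.ne).isUnit).mul_right
      (isCoprime_X_sub_C h0)).mul_left (h1.symm.mul_right hp.symm)

theorem card_eval_eq_zero :
    Nat.card {p : E[X] // ((p.Monic ∧ p.natDegree = n + 1) ∧ IsCoprime p (conj φ p)) ∧
      p.eval (φ α) = 0} = twistedCount φ α n := by
  symm
  refine Nat.card_congr (Equiv.ofBijective (fun p ↦ ⟨(X - C (φ α)) * conj φ p.1,
    ⟨⟨(monic_X_sub_C _).mul (monic_conj p.2.1), ?_⟩,
      h.isCoprime_conj_X_sub_C_mul_iff.mpr p.2.2.2⟩, by simp⟩) ⟨?_, ?_⟩)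
  · rw [(monic_X_sub_C _).natDegree_mul (monic_conj p.2.1), natDegree_X_sub_C, natDegree_conj,
      p.2.2.1, add_comm]
  · rintro ⟨p, _⟩ ⟨p', _⟩ heq
    have h1 := congrArg (conj φ) (mul_left_cancel₀ (X_sub_C_ne_zero _) (Subtype.mk.inj heq))
    rw [h.conj_conj, h.conj_conj] at h1
    exact Subtype.ext h1
  · rintro ⟨p, ⟨⟨hp, hpn⟩, hc⟩, h0⟩
    obtain ⟨u, rfl⟩ := dvd_iff_isRoot.mpr h0
    have hu := (monic_X_sub_C _).of_mul_monic_left hp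
    rw [(monic_X_sub_C _).natDegree_mul hu, natDegree_X_sub_C, add_comm, add_left_inj] at hpn
    rw [← h.conj_conj u, h.isCoprime_conj_X_sub_C_mul_iff] at hc
    exact ⟨⟨conj φ u, monic_conj hu, (natDegree_conj u).trans hpn, hc⟩,
      Subtype.ext (congrArg ((X - C (φ α)) * ·) (h.conj_conj u))⟩

variable [Finite F] [Finite E]

theorem twistedCount_succ : twistedCount φ α n + twistedCount φ α (n + 1) +
    Nat.card F ^ (2 * n + 1) = Nat.card F ^ (2 * n + 2) := by
  rw [← card_coprimePairs_succ, ← h.card_monic_isCoprime_conj, ← h.card_eval_eq_zero,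
    add_left_inj]
  let P (p : E[X]) : Prop := (p.Monic ∧ p.natDegree = n + 1) ∧ IsCoprime p (conj φ p)
  have h1 (Q : E[X] → Prop) : Finite {p // P p ∧ Q p} := finite_subtype_of_imp fun p hp ↦ hp.1.1
  rw [← card_subtype_add_card_subtype P fun p ↦ p.eval (φ α) = 0]
  congr 1
  exact Nat.card_congr (Equiv.subtypeEquivRight fun p ↦ by simp only [P, and_assoc, ne_eq])

theorem cast_twistedCount : (twistedCount φ α n : ℚ) =
    ((-1) ^ n * (1 + (Nat.card F : ℚ)) + (Nat.card F : ℚ) ^ (2 * n + 1) * ((Nat.card F : ℚ) - 1)) /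
      (1 + (Nat.card F : ℚ) ^ 2) := by
  have hq : (1 + (Nat.card F : ℚ) ^ 2) ≠ 0 := by positivity
  rw [eq_div_iff hq]
  induction n with
  | zero => rw [twistedCount_zero]; push_cast; ring
  | succ n ih =>
    have h1 : (twistedCount φ α n + twistedCount φ α (n + 1) : ℚ) +
      (Nat.card F : ℚ) ^ (2 * n + 1) = (Nat.card F : ℚ) ^ (2 * n + 2) := by
        exact_mod_cast h.twistedCount_succ
    linear_combination (1 + (Nat.card F : ℚ) ^ 2) * h1 - ih

end IsConjElement

end CountConjCoprime

section CountStable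

instance {k : Type*} [Field k] [Finite k] (n : ℕ) :
    Finite {W : Submodule k k[X] // IsPencil n W} :=
  .of_surjective (fun p : {p : k[X] × k[X] // FormCoprime n n p.1 p.2} ↦
    ⟨Submodule.span k {p.1.1, p.1.2}, p.1.1, p.1.2, p.2, rfl⟩) fun ⟨_, a, b, hab, h⟩ ↦
      ⟨⟨(a, b), hab⟩, Subtype.ext h.symm⟩

namespace IsConjElement

variable {F E : Type*} [Field F] [Field E] [Algebra F E] {φ : E →ₐ[F] E} {α : E} {d k : ℕ}
  (h : IsConjElement φ α d) {s t : F} (hs : algebraMap F E s = α + φ α)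
  (ht : algebraMap F E t = α * φ α) [Finite F]

include h hs ht

theorem card_stable_pencil_eq_add {m : F} (hm : algebraMap F E m = α ^ (d * (k + 1))) :
    Nat.card {W : Submodule F F[X] // IsPencil (d * (k + 1)) W ∧
      ∀ w ∈ W, homSubst (d * (k + 1)) (C s * X - C t) X w ∈ W} =
    Nat.card F ^ (2 * k) + Nat.card {W : Submodule F F[X] // (IsPencil (d * (k + 1)) W ∧
      ∀ w ∈ W, homSubst (d * (k + 1)) (C s * X - C t) X w ∈ W) ∧
      ¬ ∀ w ∈ W, homSubst (d * (k + 1)) (C s * X - C t) X w = C m * w} := by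
  let P (W : Submodule F F[X]) : Prop := IsPencil (d * (k + 1)) W ∧
    ∀ w ∈ W, homSubst (d * (k + 1)) (C s * X - C t) X w ∈ W
  let Q (W : Submodule F F[X]) : Prop :=
    ∀ w ∈ W, homSubst (d * (k + 1)) (C s * X - C t) X w = C m * w
  have hfin (R : Submodule F F[X] → Prop) : Finite {W // P W ∧ R W} :=
    finite_subtype_of_imp fun W hW ↦ hW.1.1
  have hQ : Nat.card {W // P W ∧ Q W} = Nat.card F ^ (2 * k) := by
    rw [← card_pencil_succ, ← card_scalar_pencil h hs ht hm]
    refine Nat.card_congr (Equiv.subtypeEquivRight fun W ↦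
      ⟨fun hW ↦ ⟨hW.1.1, hW.2⟩, fun hW ↦ ⟨⟨hW.1, fun w hw ↦ ?_⟩, hW.2⟩⟩)
    rw [hW.2 w hw, ← smul_eq_C_mul]
    exact W.smul_mem m hw
  exact (card_subtype_add_card_subtype P Q).symm.trans (congrArg (· + _) hQ)

theorem card_stable_pencil_of_even (hd : Even d) {m : F}
    (hm : algebraMap F E m = α ^ (d * (k + 1))) :
    Nat.card {W : Submodule F F[X] // IsPencil (d * (k + 1)) W ∧
      ∀ w ∈ W, homSubst (d * (k + 1)) (C s * X - C t) X w ∈ W} =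
    Nat.card F ^ (2 * k) + nonscalarCount F α k := by
  rw [h.card_stable_pencil_eq_add hs ht hm, card_nonscalar_pencil h hs ht hd hm, nonscalarCount]

theorem card_stable_pencil_of_odd (hd : ¬ Even d) {m : F}
    (hm : algebraMap F E m = α ^ (d * (k + 1))) :
    Nat.card {W : Submodule F F[X] // IsPencil (d * (k + 1)) W ∧
      ∀ w ∈ W, homSubst (d * (k + 1)) (C s * X - C t) X w ∈ W} = Nat.card F ^ (2 * k) := by
  rw [h.card_stable_pencil_eq_add hs ht hm, add_eq_left]
  have : IsEmpty {W : Submodule F F[X] // (IsPencil (d * (k + 1)) W ∧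
      ∀ w ∈ W, homSubst (d * (k + 1)) (C s * X - C t) X w ∈ W) ∧
      ¬ ∀ w ∈ W, homSubst (d * (k + 1)) (C s * X - C t) X w = C m * w} :=
    ⟨fun ⟨_, ⟨hW, hst⟩, hns⟩ ↦
      hd (h.exists_of_not_scalar hs ht (Nat.mul_pos h.pos k.succ_pos) hm hW hst hns).1⟩
  exact Nat.card_of_isEmpty

end IsConjElement

theorem isConjElement_frobenius {F E : Type*} [Field F] [Fintype F] [Field E] [Fintype E]
    [Algebra F E] (hE : Fintype.card E = Fintype.card F ^ 2) {α : E}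
    (hα : α ∉ Set.range (algebraMap F E)) :
    IsConjElement (FiniteField.frobeniusAlgHom F E) α (orderOf (α ^ (Fintype.card F - 1))) := by
  have hfix (x : E) (hx : x ^ Fintype.card F = x) : x ∈ Set.range (algebraMap F E) := by
    classical
    have hdvd : (X ^ Fintype.card F - X : F[X]) ≠ 0 :=
      FiniteField.X_pow_card_sub_X_ne_zero F Fintype.one_lt_card
    have hroots := FiniteField.roots_X_pow_card_sub_X F
    have hsplit : (X ^ Fintype.card F - X : F[X]).Splits := by
      rw [splits_iff_card_roots, hroots, FiniteField.X_pow_card_sub_X_natDegree_eq F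
        Fintype.one_lt_card]
      rfl
    exact hsplit.mem_range_of_isRoot hdvd (by simp [hx])
  have hα0 : α ≠ 0 := by
    rintro rfl
    exact hα ⟨0, map_zero _⟩
  have hmul (i : ℕ) : (α ^ Fintype.card F) ^ i = α ^ i * (α ^ (Fintype.card F - 1)) ^ i := by
    rw [← mul_pow, ← pow_succ', Nat.sub_add_cancel Fintype.card_pos]
  have hpow (i : ℕ) : α ^ i = (α ^ Fintype.card F) ^ i ↔ (α ^ (Fintype.card F - 1)) ^ i = 1 := by
    rw [hmul, eq_comm, mul_eq_left₀ (pow_ne_zero _ hα0)]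
  have hfinite : IsOfFinOrder (α ^ (Fintype.card F - 1)) := by
    rw [isOfFinOrder_iff_pow_eq_one]
    refine ⟨Fintype.card E - 1, Nat.sub_pos_of_lt Fintype.one_lt_card, ?_⟩
    exact FiniteField.pow_card_sub_one_eq_one _ (pow_ne_zero _ hα0)
  refine ⟨fun x ↦ ?_, fun x hx ↦ hfix x hx, fun h ↦ hα (hfix α h), hfinite.orderOf_pos, ?_,
    fun i hi hid ↦ ?_⟩
  · change (x ^ Fintype.card F) ^ Fintype.card F = x
    rw [← pow_mul, ← sq, ← hE, FiniteField.pow_card]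
  · exact (hpow _).mpr (pow_orderOf_eq_one _)
  · exact fun h ↦ pow_ne_one_of_lt_orderOf hi.ne' hid ((hpow i).mp h)

end CountStable

/-- Theorem 4.5: the number of intermediate fields of `F_q(X)/F_q` of codegree `n`
fixed by the automorphism `X ↦ ((α + α^q)X - α^(1+q))/X`, where
`α ∈ F_{q^2} \ F_q` and `d` is the multiplicative order of `α^(q-1)`. -/
theorem fix_irreducible (q n : ℕ) (hq : IsPrimePow q) (hn : 1 ≤ n)
    (F E : Type*) [Field F] [Fintype F] (hF : Fintype.card F = q)
    [Field E] [Fintype E] (hE : Fintype.card E = q ^ 2) [Algebra F E]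
    (α : E) (hα : α ∉ Set.range (algebraMap F E))
    (s t : F) (hs : algebraMap F E s = α + α ^ q)
    (ht : algebraMap F E t = α ^ (1 + q))
    (d : ℕ) (hd : d = orderOf (α ^ (q - 1)))
    (σ : RatFunc F ≃ₐ[F] RatFunc F)
    (hσ : σ RatFunc.X = (RatFunc.C s * RatFunc.X - RatFunc.C t) / RatFunc.X) :
    (Nat.card {K : IntermediateField F (RatFunc F) //
        Module.finrank K (RatFunc F) = n ∧ K.map σ.toAlgHom = K} : ℚ) =
      if d ∣ n then
        if Even d then
          (q : ℚ) ^ (2 * (n / d) - 2) +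
            ((q : ℚ) + 1) * ((q : ℚ) ^ (2 * (n / d)) - (-1 : ℚ) ^ (n / d)) /
              ((q : ℚ) ^ 2 + 1)
        else (q : ℚ) ^ (2 * (n / d) - 2)
      else
        ((-1 : ℚ) ^ (n / d) * (1 + (q : ℚ)) +
          (q : ℚ) ^ (2 * (n / d) + 1) * ((q : ℚ) - 1)) / (1 + (q : ℚ) ^ 2) := by
  subst hF hd
  have hc : Nat.card F = Fintype.card F := Nat.card_eq_fintype_card
  have h := isConjElement_frobenius hE hα
  set φ := FiniteField.frobeniusAlgHom F E
  set d := orderOf (α ^ (Fintype.card F - 1))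
  have hφα : φ α = α ^ Fintype.card F := rfl
  have hs' : algebraMap F E s = α + φ α := hs
  have ht' : algebraMap F E t = α * φ α := by rw [ht, hφα, pow_add, pow_one]
  rw [card_fixed_eq_card_stable_pencil hn σ (natDegree_linear_le s t) natDegree_X_le X_ne_zero
    (by rw [hσ]; simp), ← hc]
  split_ifs with hdn hd
  · obtain ⟨_ | k, rfl⟩ := hdn
    · omega
    obtain ⟨m, hm⟩ := h.fixed (α ^ (d * (k + 1))) (by
      rw [map_pow, eq_comm, h.pow_eq_iff]; exact dvd_mul_right _ _)
    rw [h.card_stable_pencil_of_even hs' ht' hd hm, Nat.cast_add, cast_nonscalarCount h hs' ht',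
      Nat.mul_div_cancel_left _ h.pos, Nat.cast_pow]
    rfl
  · obtain ⟨_ | k, rfl⟩ := hdn
    · omega
    obtain ⟨m, hm⟩ := h.fixed (α ^ (d * (k + 1))) (by
      rw [map_pow, eq_comm, h.pow_eq_iff]; exact dvd_mul_right _ _)
    rw [h.card_stable_pencil_of_odd hs' ht' hd hm, Nat.mul_div_cancel_left _ h.pos, Nat.cast_pow]
    rfl
  · rw [card_stable_pencil_of_not_dvd h hs' ht'
      (Nat.pos_of_ne_zero fun h0 ↦ hdn (Nat.dvd_of_mod_eq_zero h0)) (Nat.mod_lt n h.pos)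
      (Nat.mod_add_div n d).symm]
    exact h.cast_twistedCount
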